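/- arXiv:1206.2128 — 4 statements merged into one kernel-verified Lean document; each statement's English description precedes it below -/
import Mathlib

section
/- Let n ≥ 3 and let R be a commutative ring with 1. Then the elementary subgroup E(n,R) is a normal subgroup of SL(n,R). -/
open Matrix

/-- The elementary transvection `e + ξ e_{ij}` as an element of `SL(n,R)`. -/
def elemT {n : ℕ} {R : Type*} [CommRing R] (i j : Fin n) (hij : i ≠ j) (ξ : R) :
    Matrix.SpecialLinearGroup (Fin n) R :=
  ⟨Matrix.transvection i j ξ, Matrix.det_transvection_of_ne i j hij ξ⟩

/-- The set of elementary transvections in `SL(n,R)`. -/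
def elemSet (n : ℕ) (R : Type*) [CommRing R] :
    Set (Matrix.SpecialLinearGroup (Fin n) R) :=
  { g | ∃ i j : Fin n, ∃ hij : i ≠ j, ∃ ξ : R, g = elemT i j hij ξ }

/-- The elementary subgroup `E(n,R)` of `SL(n,R)`. -/
def elemSubgroup (n : ℕ) (R : Type*) [CommRing R] :
    Subgroup (Matrix.SpecialLinearGroup (Fin n) R) :=
  Subgroup.closure (elemSet n R)

/-- `g` is a product of at most `N` elementary transvections. -/
def IsElemProd (n : ℕ) (R : Type*) [CommRing R] (N : ℕ)
    (g : Matrix.SpecialLinearGroup (Fin n) R) : Prop :=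
  ∃ L : List (Matrix.SpecialLinearGroup (Fin n) R),
    L.length ≤ N ∧ (∀ x ∈ L, x ∈ elemSet n R) ∧ g = L.prod

/-- If the `A i` have pairwise (and self) products zero and every `1 + A i` lies in a submonoid,
then so does `1 + ∑ A i`. -/
theorem Submonoid.one_add_sum_mem {M ι : Type*} [Ring M] (S : Submonoid M) (s : Finset ι)
    (A : ι → M) (hA : ∀ i j, A i * A j = 0) (hS : ∀ i, 1 + A i ∈ S) :
    1 + ∑ i ∈ s, A i ∈ S := by
  classical
  induction s using Finset.induction_on with
  | empty => simp
  | insert a s ha ih =>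
    have h : 1 + ∑ i ∈ insert a s, A i = (1 + A a) * (1 + ∑ i ∈ s, A i) := by
      have h₀ : A a * ∑ i ∈ s, A i = 0 := by
        rw [Finset.mul_sum, Finset.sum_eq_zero fun j _ => hA a j]
      rw [Finset.sum_insert ha, mul_add, mul_one, add_mul 1, h₀, one_mul, add_zero, add_assoc]
    rw [h]
    exact S.mul_mem (hS a) ih

/-- The matrices underlying the elements of `E(n,R)`. -/
def elemMatrices (n : ℕ) (R : Type*) [CommRing R] : Submonoid (Matrix (Fin n) (Fin n) R) where
  carrier := { M | ∃ g ∈ elemSubgroup n R, (g : Matrix (Fin n) (Fin n) R) = M }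
  one_mem' := ⟨1, one_mem _, rfl⟩
  mul_mem' := by
    rintro _ _ ⟨g, hg, rfl⟩ ⟨h, hh, rfl⟩
    exact ⟨g * h, mul_mem hg hh, rfl⟩

section

variable {n : ℕ} {R : Type*} [CommRing R]

theorem transvection_mem_elemMatrices {i j : Fin n} (hij : i ≠ j) (ξ : R) :
    transvection i j ξ ∈ elemMatrices n R :=
  ⟨elemT i j hij ξ, Subgroup.subset_closure ⟨i, j, hij, ξ, rfl⟩, rfl⟩

theorem one_add_single_mem_elemMatrices {i j : Fin n} {ξ : R} (h : i = j → ξ = 0) :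
    1 + single i j ξ ∈ elemMatrices n R := by
  by_cases hij : i = j
  · simp [h hij]
  · exact transvection_mem_elemMatrices hij ξ

theorem one_add_vecMulVec_single_left_mem {m : Fin n} {v : Fin n → R} (a : R) (hv : v m = 0) :
    1 + vecMulVec (Pi.single m a) v ∈ elemMatrices n R := by
  have h : vecMulVec (Pi.single m a) v = ∑ k, single m k (a * v k) := by
    ext i j
    simp [vecMulVec_apply, Matrix.sum_apply, single_apply, Pi.single_apply, ite_and, eq_comm]
  rw [h]
  refine Submonoid.one_add_sum_mem _ _ _ (fun i j => ?_) fun i =>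
    one_add_single_mem_elemMatrices ?_
  · by_cases him : i = m
    · simp [him, hv]
    · exact single_mul_single_of_ne _ _ _ _ him _
  · rintro rfl
    simp [hv]

theorem one_add_vecMulVec_single_right_mem {m : Fin n} {u : Fin n → R} (a : R) (hu : u m = 0) :
    1 + vecMulVec u (Pi.single m a) ∈ elemMatrices n R := by
  have h : vecMulVec u (Pi.single m a) = ∑ k, single k m (u k * a) := by
    ext i j
    simp [vecMulVec_apply, Matrix.sum_apply, single_apply, Pi.single_apply, ite_and, eq_comm]
  rw [h]
  refine Submonoid.one_add_sum_mem _ _ _ (fun i j => ?_) fun i =>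
    one_add_single_mem_elemMatrices ?_
  · by_cases hjm : m = j
    · simp [← hjm, hu]
    · exact single_mul_single_of_ne _ _ _ _ hjm _
  · rintro rfl
    simp [hu]

/-- The Whitehead–Vaserstein commutator trick. -/
theorem one_add_vecMulVec_mem_of_apply_eq_zero_of_apply_eq_zero {m : Fin n} {u v : Fin n → R}
    (hu : u m = 0) (hv : v m = 0) (huv : v ⬝ᵥ u = 0) :
    1 + vecMulVec u v ∈ elemMatrices n R := by
  set A := vecMulVec u (Pi.single m (1 : R)) with hA
  set B := vecMulVec (Pi.single m (1 : R)) v with hB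
  have hAA : A * A = 0 := by simp [hA, vecMulVec_mul_vecMulVec, hu]
  have hBB : B * B = 0 := by simp [hB, vecMulVec_mul_vecMulVec, hv]
  have hBA : B * A = 0 := by simp [hA, hB, vecMulVec_mul_vecMulVec, huv]
  have hAB : A * B = vecMulVec u v := by simp [hA, hB, vecMulVec_mul_vecMulVec]
  have hA' : 1 - A ∈ elemMatrices n R := by
    have := one_add_vecMulVec_single_right_mem (m := m) (u := -u) (1 : R) (by simp [hu])
    rwa [neg_vecMulVec, ← sub_eq_add_neg] at this
  have hB' : 1 - B ∈ elemMatrices n R := by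
    have := one_add_vecMulVec_single_left_mem (m := m) (v := -v) (1 : R) (by simp [hv])
    rwa [vecMulVec_neg, ← sub_eq_add_neg] at this
  have h : 1 + vecMulVec u v = (1 + A) * (1 + B) * ((1 - A) * (1 - B)) := by
    have h₁ : (1 + A) * (1 + B) * ((1 - A) * (1 - B)) =
        1 + A * B - A * A - B * B - B * A - A * (B * A) - A * (B * B) + A * A * B
          + B * A * B + A * (B * A) * B := by
      noncomm_ring
    rw [h₁, hAA, hBB, hBA, hAB]
    simp
  rw [h]
  exact mul_mem (mul_mem (one_add_vecMulVec_single_right_mem 1 hu)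
    (one_add_vecMulVec_single_left_mem 1 hv)) (mul_mem hA' hB')

theorem one_add_vecMulVec_mem_of_apply_eq_zero {m : Fin n} {u v : Fin n → R}
    (hv : v m = 0) (huv : v ⬝ᵥ u = 0) : 1 + vecMulVec u v ∈ elemMatrices n R := by
  have h : 1 + vecMulVec u v = (1 + vecMulVec (u - Pi.single m (u m)) v) *
      (1 + vecMulVec (Pi.single m (u m)) v) := by
    have h₀ : vecMulVec (u - Pi.single m (u m)) v * vecMulVec (Pi.single m (u m)) v = 0 := by
      simp [vecMulVec_mul_vecMulVec, hv]
    rw [mul_add, add_mul, add_mul, h₀, sub_vecMulVec]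
    simp only [mul_one, one_mul, add_zero]
    abel
  rw [h]
  refine mul_mem (one_add_vecMulVec_mem_of_apply_eq_zero_of_apply_eq_zero (m := m) ?_ hv ?_)
    (one_add_vecMulVec_single_left_mem _ hv)
  · simp
  · simp [dotProduct_sub, huv, hv]

/-- Suslin's lemma: if `u` is unimodular and `v` is orthogonal to `u`, then `v` is a sum of
vectors orthogonal to `u` having at most two nonzero coordinates. -/
theorem one_add_vecMulVec_mem_of_unimodular (hn : 3 ≤ n) {u v w : Fin n → R}
    (hw : w ⬝ᵥ u = 1) (huv : v ⬝ᵥ u = 0) : 1 + vecMulVec u v ∈ elemMatrices n R := by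
  let f : Fin n × Fin n → Fin n → R := fun p =>
    (v p.1 * w p.2) • (Pi.single p.1 (u p.2) - Pi.single p.2 (u p.1))
  have hf : ∀ p, f p ⬝ᵥ u = 0 := fun p => by
    simp [f, sub_dotProduct, mul_comm]
  have hsum : v = ∑ p, f p := by
    ext i
    have h₁ : ∑ l, v i * w l * u l = v i := by
      simp_rw [mul_assoc, ← Finset.mul_sum]
      rw [show ∑ l, w l * u l = 1 from hw, mul_one]
    have h₂ : ∑ k, v k * w i * u k = 0 := by
      simp_rw [mul_right_comm _ (w i), ← Finset.sum_mul]
      rw [show ∑ k, v k * u k = 0 from huv, zero_mul]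
    simp only [f, Finset.sum_apply, Fintype.sum_prod_type, Pi.smul_apply, Pi.sub_apply,
      smul_eq_mul, mul_sub, Finset.sum_sub_distrib, Pi.single_apply, mul_ite, mul_zero]
    rw [Finset.sum_comm]
    simp [h₁, h₂]
  have hmat : vecMulVec u v = ∑ p, vecMulVec u (f p) := by
    conv_lhs => rw [hsum]
    ext i j
    simp [vecMulVec_apply, Matrix.sum_apply, Finset.mul_sum]
  rw [hmat]
  refine Submonoid.one_add_sum_mem _ _ _ (fun p q => ?_) fun p => ?_
  · simp [vecMulVec_mul_vecMulVec, hf]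
  · obtain ⟨m, hm⟩ : ∃ m, m ∉ ({p.1, p.2} : Finset (Fin n)) := by
      refine Finset.exists_mem_notMem_of_card_lt_card (t := Finset.univ) ?_ |>.imp fun _ h => h.2
      have := Finset.card_le_two (a := p.1) (b := p.2)
      rw [Finset.card_univ, Fintype.card_fin]
      omega
    simp only [Finset.mem_insert, Finset.mem_singleton, not_or] at hm
    exact one_add_vecMulVec_mem_of_apply_eq_zero (m := m) (by simp [f, hm.1, hm.2]) (hf p)

theorem conj_transvection_mem_elemMatrices (hn : 3 ≤ n) {g h : Matrix (Fin n) (Fin n) R}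
    (hgh : g * h = 1) {i j : Fin n} (hij : i ≠ j) (ξ : R) :
    g * transvection i j ξ * h ∈ elemMatrices n R := by
  have hdot : ∀ k, h k ⬝ᵥ g.col i = (1 : Matrix (Fin n) (Fin n) R) k i := fun k => by
    rw [← mul_eq_one_comm.1 hgh]
    rfl
  have hval : g * transvection i j ξ * h = 1 + vecMulVec (g.col i) (ξ • h j) := by
    rw [transvection, mul_add, add_mul, mul_one, hgh]
    congr 1
    ext a b
    simp [vecMulVec_apply, mul_apply, single_apply, ite_and, mul_assoc]
  rw [hval]
  refine one_add_vecMulVec_mem_of_unimodular hn (w := h i) ?_ ?_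
  · simp [hdot]
  · simp [smul_dotProduct, hdot, hij.symm]

theorem conj_elemT_mem_elemSubgroup (hn : 3 ≤ n) (g : SpecialLinearGroup (Fin n) R)
    {i j : Fin n} (hij : i ≠ j) (ξ : R) : g * elemT i j hij ξ * g⁻¹ ∈ elemSubgroup n R := by
  have hinv : (g : Matrix (Fin n) (Fin n) R) * (g⁻¹ : SpecialLinearGroup (Fin n) R) = 1 :=
    congrArg Subtype.val (mul_inv_cancel g)
  obtain ⟨h, hh, h_eq⟩ := conj_transvection_mem_elemMatrices hn hinv hij ξ
  have : h = g * elemT i j hij ξ * g⁻¹ := Subtype.ext h_eq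
  rwa [← this]

end

/-- Suslin's normality theorem: for n ≥ 3, the elementary subgroup E(n,R)
is a normal subgroup of SL(n,R). -/
theorem elemSubgroup_normal (n : ℕ) (hn : 3 ≤ n) (R : Type*) [CommRing R] :
    (elemSubgroup n R).Normal := by
  refine ⟨fun h hh g => ?_⟩
  suffices elemSubgroup n R ≤ (elemSubgroup n R).comap (MulAut.conj g).toMonoidHom from this hh
  refine (Subgroup.closure_le _).2 ?_
  rintro _ ⟨i, j, hij, ξ, rfl⟩
  exact conj_elemT_mem_elemSubgroup hn g hij ξ
end

section
/- Let n ≥ 3 and let R be a commutative ring of stable rank 1. Then E(n,R) = U⁺·U⁻·U⁺·U⁻; that is, every element of E(n,R) can be written as a product u₁·v₁·u₂·v₂ where u₁,u₂ are upper unitriangular matrices and v₁,v₂ are lower unitriangular matrices in SL(n,R). -/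
open Matrix

/-- R has stable rank 1: whenever aR + bR = R, there is z with a + bz invertible. -/
def StableRankOne (R : Type*) [CommRing R] : Prop :=
  ∀ a b : R, Ideal.span {a, b} = ⊤ → ∃ z : R, IsUnit (a + b * z)

/-- g is upper unitriangular: diagonal entries 1, entries below the diagonal 0. -/
def IsUpperUnitriangular {n : ℕ} {R : Type*} [CommRing R]
    (g : Matrix.SpecialLinearGroup (Fin n) R) : Prop :=
  (∀ i : Fin n, (g : Matrix (Fin n) (Fin n) R) i i = 1) ∧
    ∀ i j : Fin n, j < i → (g : Matrix (Fin n) (Fin n) R) i j = 0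

/-- g is lower unitriangular: diagonal entries 1, entries above the diagonal 0. -/
def IsLowerUnitriangular {n : ℕ} {R : Type*} [CommRing R]
    (g : Matrix.SpecialLinearGroup (Fin n) R) : Prop :=
  (∀ i : Fin n, (g : Matrix (Fin n) (Fin n) R) i i = 1) ∧
    ∀ i j : Fin n, i < j → (g : Matrix (Fin n) (Fin n) R) i j = 0

namespace Matrix

/-- An upper triangular matrix all of whose diagonal entries are `1`. -/
def UpperUnitriangular {m R : Type*} [LinearOrder m] [CommRing R] (M : Matrix m m R) : Prop :=
  (∀ i, M i i = 1) ∧ ∀ i j, j < i → M i j = 0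

/-- A lower triangular matrix all of whose diagonal entries are `1`. -/
def LowerUnitriangular {m R : Type*} [LinearOrder m] [CommRing R] (M : Matrix m m R) : Prop :=
  (∀ i, M i i = 1) ∧ ∀ i j, i < j → M i j = 0

section Unitriangular

variable {m R : Type*} [LinearOrder m] [CommRing R]

theorem UpperUnitriangular.one : UpperUnitriangular (1 : Matrix m m R) :=
  ⟨fun _ => one_apply_eq _, fun _ _ h => one_apply_ne h.ne'⟩

theorem LowerUnitriangular.one : LowerUnitriangular (1 : Matrix m m R) :=
  ⟨fun _ => one_apply_eq _, fun _ _ h => one_apply_ne h.ne⟩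

variable [Fintype m]

theorem UpperUnitriangular.det_eq_one {M : Matrix m m R} (hM : UpperUnitriangular M) :
    M.det = 1 := by
  rw [det_of_isUpperTriangular (fun i j h => hM.2 i j h)]
  simp [hM.1]

theorem LowerUnitriangular.det_eq_one {M : Matrix m m R} (hM : LowerUnitriangular M) :
    M.det = 1 := by
  rw [det_of_isLowerTriangular M (fun i j h => hM.2 i j h)]
  simp [hM.1]

theorem LowerUnitriangular.mul {M N : Matrix m m R} (hM : LowerUnitriangular M)
    (hN : LowerUnitriangular N) : LowerUnitriangular (M * N) := by
  refine ⟨fun i => ?_, fun i j hij => Finset.sum_eq_zero fun k _ => ?_⟩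
  · rw [mul_apply, Finset.sum_eq_single i, hM.1, hN.1, one_mul]
    · intro k _ hk
      rcases lt_or_gt_of_ne hk with h | h
      · rw [hN.2 k i h, mul_zero]
      · rw [hM.2 i k h, zero_mul]
    · simp
  · rcases lt_or_ge i k with h | h
    · simp [hM.2 i k h]
    · simp [hN.2 k j (h.trans_lt hij)]

end Unitriangular

section Blocks

variable {k : ℕ} {R : Type*} [CommRing R]

theorem UpperUnitriangular.fromBlocks {A : Matrix (Fin k) (Fin k) R} (hA : UpperUnitriangular A)
    (B : Matrix (Fin k) (Fin 1) R) :
    UpperUnitriangular ((Matrix.fromBlocks A B 0 1).submatrix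
      (finSumFinEquiv (m := k) (n := 1)).symm finSumFinEquiv.symm) := by
  refine ⟨fun i => ?_, fun i j => ?_⟩
  · induction i using Fin.lastCases <;> simp [finSumFinEquiv_symm_last, hA.1]
  · induction i using Fin.lastCases <;> induction j using Fin.lastCases <;>
      simp +contextual [finSumFinEquiv_symm_last, hA.2, (Fin.le_last _).not_gt]

theorem LowerUnitriangular.fromBlocks {A : Matrix (Fin k) (Fin k) R} (hA : LowerUnitriangular A)
    (C : Matrix (Fin 1) (Fin k) R) :
    LowerUnitriangular ((Matrix.fromBlocks A 0 C 1).submatrix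
      (finSumFinEquiv (m := k) (n := 1)).symm finSumFinEquiv.symm) := by
  refine ⟨fun i => ?_, fun i j => ?_⟩
  · induction i using Fin.lastCases <;> simp [finSumFinEquiv_symm_last, hA.1]
  · induction i using Fin.lastCases <;> induction j using Fin.lastCases <;>
      simp +contextual [finSumFinEquiv_symm_last, hA.2, (Fin.le_last _).not_gt]

variable {m n : Type*} [Fintype m] [Fintype n] [DecidableEq m] [DecidableEq n]

theorem det_fromBlocks_of_mul_add_eq_one {A : Matrix m m R} {B : Matrix m n R}
    {C : Matrix n m R} {D : Matrix n n R} {p : Matrix m n R} (hp : C * p + D = 1) :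
    (fromBlocks A B C D).det = (A - (A * p + B) * C).det := by
  have h : fromBlocks A B C D * fromBlocks 1 p 0 1 =
      fromBlocks (A - (A * p + B) * C) (A * p + B) 0 1 * fromBlocks 1 0 C 1 := by
    simp [fromBlocks_multiply, hp]
  simpa using congrArg det h

theorem fromBlocks_eq_mul_of_mul_add_eq_one {A : Matrix m m R} {B : Matrix m n R}
    {C : Matrix n m R} {D : Matrix n n R} {p : Matrix m n R} (hp : C * p + D = 1)
    {u₁ v₁ u₂ v₂ w : Matrix m m R} (h : A - (A * p + B) * C = u₁ * v₁ * u₂ * v₂)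
    (hw : w * (u₂ * v₂) = 1) :
    fromBlocks A B C D =
      fromBlocks u₁ (A * p + B) 0 1 * fromBlocks v₁ 0 (C * w) 1 *
        fromBlocks u₂ (-(u₂ * v₂ * p)) 0 1 * fromBlocks v₂ 0 0 1 := by
  have hwp : w * (u₂ * (v₂ * p)) = p := by
    rw [← Matrix.mul_assoc u₂, ← Matrix.mul_assoc, hw, Matrix.one_mul]
  have hp' : u₁ * (v₁ * (u₂ * (v₂ * p))) = (A - (A * p + B) * C) * p := by
    simp only [h, Matrix.mul_assoc]
  have hD : D = 1 - C * p := eq_sub_of_add_eq' hp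
  simp only [Matrix.mul_assoc] at h
  simp only [fromBlocks_multiply, Matrix.mul_assoc, Matrix.add_mul, Matrix.mul_neg, hw, hwp,
    fromBlocks_inj, Matrix.mul_one, Matrix.zero_mul, Matrix.mul_zero, Matrix.one_mul,
    add_zero, zero_add, hp', ← h, true_and]
  refine ⟨by abel, ?_, by rw [hD]; abel⟩
  simp only [Matrix.sub_mul, Matrix.add_mul, Matrix.mul_assoc]
  abel

end Blocks

/-- Over a ring of stable rank one, a row of a matrix of determinant one can be changed so that
its first entry is invertible, by adding multiples of the other columns to the first one. -/
theorem exists_isUnit_mul_apply_zero {R : Type*} [CommRing R] (hR : StableRankOne R) {k : ℕ}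
    (G : Matrix (Fin (k + 1)) (Fin (k + 1)) R) (hG : G.det = 1) (i : Fin (k + 1)) :
    ∃ V W : Matrix (Fin (k + 1)) (Fin (k + 1)) R,
      LowerUnitriangular W ∧ V * W = 1 ∧ V.det = 1 ∧ IsUnit ((G * V) i 0) := by
  have hrow : ∑ j, G i j * G.adjugate j i = 1 := by
    rw [← mul_apply, mul_adjugate, hG, one_smul, one_apply_eq]
  rw [Fin.sum_univ_succ] at hrow
  obtain ⟨t, ht⟩ := hR (G i 0) (∑ j : Fin k, G i j.succ * G.adjugate j.succ i) (by
    rw [Ideal.eq_top_iff_one, Ideal.mem_span_pair]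
    exact ⟨G.adjugate 0 i, 1, by linear_combination hrow⟩)
  let z : Fin (k + 1) → R := Fin.cons 0 fun j => G.adjugate j.succ i * t
  let N : Matrix (Fin (k + 1)) (Fin (k + 1)) R := vecMulVec z (Pi.single 0 1)
  have hN : N * N = 0 := by simp [N, z, vecMulVec_mul_vecMulVec]
  have hlow (c : R) : LowerUnitriangular (1 + c • N) := by
    refine ⟨fun j => ?_, fun j l hjl => ?_⟩
    · cases j using Fin.cases <;> simp [N, z, vecMulVec_apply]
    · have : l ≠ 0 := (Fin.zero_le j |>.trans_lt hjl).ne'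
      simp [N, vecMulVec_apply, one_apply_ne hjl.ne, this]
  refine ⟨1 + (1 : R) • N, 1 + (-1 : R) • N, hlow _, ?_, (hlow _).det_eq_one, ?_⟩
  · simp [mul_add, add_mul, hN]
  · convert ht using 1
    simp [mul_add, N, mul_vecMulVec, vecMulVec_apply, mulVec, dotProduct, Fin.sum_univ_succ, z,
      Finset.sum_mul, mul_assoc]

theorem exists_unitriangular_factorisation {R : Type*} [CommRing R] (hR : StableRankOne R)
    {n : ℕ} (G : Matrix (Fin n) (Fin n) R) (hG : G.det = 1) :
    ∃ u₁ v₁ u₂ v₂ : Matrix (Fin n) (Fin n) R,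
      UpperUnitriangular u₁ ∧ LowerUnitriangular v₁ ∧
        UpperUnitriangular u₂ ∧ LowerUnitriangular v₂ ∧ G = u₁ * v₁ * u₂ * v₂ := by
  induction n with
  | zero => exact ⟨1, 1, 1, 1, .one, .one, .one, .one, Subsingleton.elim _ _⟩
  | succ n ih =>
  rcases n with _ | k
  · refine ⟨1, 1, 1, 1, .one, .one, .one, .one, ?_⟩
    ext i j
    fin_cases i
    fin_cases j
    simpa using hG
  obtain ⟨V, W, hW, hVW, hV, hunit⟩ := exists_isUnit_mul_apply_zero hR G hG (Fin.last _)
  let e := finSumFinEquiv (m := k + 1) (n := 1)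
  obtain ⟨A, B, C, D, hABCD⟩ : ∃ A B C D, (G * V).submatrix e e = fromBlocks A B C D :=
    ⟨_, _, _, _, (fromBlocks_toBlocks _).symm⟩
  have hC : IsUnit (C 0 0) := by
    convert hunit
    exact (congrFun (congrFun hABCD (Sum.inr 0)) (Sum.inl 0)).symm
  obtain ⟨c, hc⟩ := hC.exists_right_inv
  let p : Matrix (Fin (k + 1)) (Fin 1) R := single 0 0 (c * (1 - D 0 0))
  have hp : C * p + D = 1 := by
    ext i j
    fin_cases i
    fin_cases j
    simp [p, ← mul_assoc, hc]
  have hdet : (A - (A * p + B) * C).det = 1 := by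
    rw [← det_fromBlocks_of_mul_add_eq_one hp, ← hABCD, det_submatrix_equiv_self, det_mul, hG,
      hV, one_mul]
  obtain ⟨u₁, v₁, u₂, v₂, hu₁, hv₁, hu₂, hv₂, h⟩ := ih _ hdet
  have hw : (u₂ * v₂).adjugate * (u₂ * v₂) = 1 := by
    rw [adjugate_mul, det_mul, hu₂.det_eq_one, hv₂.det_eq_one, one_mul, one_smul]
  refine ⟨_, _, _, _, hu₁.fromBlocks (A * p + B), hv₁.fromBlocks (C * (u₂ * v₂).adjugate),
    hu₂.fromBlocks (-(u₂ * v₂ * p)), (hv₂.fromBlocks 0).mul hW, ?_⟩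
  have hGV : G * V = (fromBlocks A B C D).submatrix e.symm e.symm := by
    simp [← hABCD]
  rw [← mul_assoc, submatrix_mul_equiv, submatrix_mul_equiv, submatrix_mul_equiv,
    ← fromBlocks_eq_mul_of_mul_add_eq_one hp h hw, ← hGV, mul_assoc, hVW, mul_one]

end Matrix

/-- For n ≥ 3 and sr(R) = 1, E(n,R) = U⁺U⁻U⁺U⁻. -/
theorem elem_eq_unitriangular_factorisation (n : ℕ) (hn : 3 ≤ n)
    (R : Type*) [CommRing R] (hR : StableRankOne R) :
    ∀ g ∈ elemSubgroup n R,
      ∃ u₁ v₁ u₂ v₂ : Matrix.SpecialLinearGroup (Fin n) R,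
        IsUpperUnitriangular u₁ ∧ IsLowerUnitriangular v₁ ∧
        IsUpperUnitriangular u₂ ∧ IsLowerUnitriangular v₂ ∧
        g = u₁ * v₁ * u₂ * v₂ := by
  intro g _
  obtain ⟨u₁, v₁, u₂, v₂, hu₁, hv₁, hu₂, hv₂, h⟩ :=
    Matrix.exists_unitriangular_factorisation hR g.1 g.2
  exact ⟨⟨u₁, hu₁.det_eq_one⟩, ⟨v₁, hv₁.det_eq_one⟩, ⟨u₂, hu₂.det_eq_one⟩, ⟨v₂, hv₂.det_eq_one⟩,
    hu₁, hv₁, hu₂, hv₂, Subtype.ext h⟩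
end

section
/- The group SL(3,ℂ[t]) does not have bounded word length with respect to the elementary generators: for every natural number N there exists a matrix g ∈ SL(3,ℂ[t]) (necessarily a product of elementary transvections) that cannot be written as a product of at most N elementary transvections. -/
open Matrix

theorem exists_derivation_extending (R S T : Type*) [CommRing R] [CommRing S] [CommRing T]
    [Algebra R S] [Algebra R T] [Algebra S T] [IsScalarTower R S T] [Algebra.FormallyEtale S T]
    (d : Derivation R S T) :
    ∃ d' : Derivation R T T, ∀ s, d' (algebraMap S T s) = d s := by
  refine ⟨(((d.liftKaehlerDifferential).liftBaseChange T).comp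
    (KaehlerDifferential.tensorKaehlerEquivOfFormallyEtale R S T).symm.toLinearMap).compDer
      (KaehlerDifferential.D R T), fun s => ?_⟩
  simp [KaehlerDifferential.tensorKaehlerEquivOfFormallyEtale_symm_D_algebraMap]

open scoped IntermediateField.algebraAdjoinAdjoin in
theorem IsTranscendenceBasis.exists_derivation {F L ι : Type*} [Field F] [Field L] [Algebra F L]
    [CharZero F] {v : ι → L} (hv : IsTranscendenceBasis F v) (w : ι → L) :
    ∃ d : Derivation F L L, ∀ i, d (v i) = w i := by
  let : Algebra (MvPolynomial ι F) L := (MvPolynomial.aeval v).toAlgebra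
  let : Algebra (MvPolynomial ι F) (Algebra.adjoin F (Set.range v)) :=
    hv.1.aevalEquiv.toRingHom.toAlgebra
  have : IsScalarTower (MvPolynomial ι F) (Algebra.adjoin F (Set.range v)) L :=
    .of_algebraMap_eq fun p => (hv.1.algebraMap_aevalEquiv p).symm
  have : IsScalarTower F (MvPolynomial ι F) L :=
    .of_algebraMap_eq fun p => ((MvPolynomial.aeval v).commutes p).symm
  have : Algebra.FormallyEtale (MvPolynomial ι F) (Algebra.adjoin F (Set.range v)) :=
    .of_equiv (A := MvPolynomial ι F)
      { hv.1.aevalEquiv with commutes' := fun p => rfl }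
  have : Algebra.FormallyEtale (Algebra.adjoin F (Set.range v))
      (IntermediateField.adjoin F (Set.range v)) :=
    .of_isLocalization (nonZeroDivisors _)
  have : Algebra.IsAlgebraic (IntermediateField.adjoin F (Set.range v)) L :=
    hv.isAlgebraic_field
  have : Algebra.FormallyEtale (IntermediateField.adjoin F (Set.range v)) L :=
    .of_isSeparable _ L
  have : Algebra.FormallyEtale (Algebra.adjoin F (Set.range v)) L :=
    .comp _ (IntermediateField.adjoin F (Set.range v)) _
  have : Algebra.FormallyEtale (MvPolynomial ι F) L :=
    .comp _ (Algebra.adjoin F (Set.range v)) _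
  obtain ⟨d, hd⟩ := exists_derivation_extending F (MvPolynomial ι F) L
    (MvPolynomial.mkDerivation F w)
  refine ⟨d, fun i => ?_⟩
  have := hd (MvPolynomial.X i)
  rw [MvPolynomial.mkDerivation_X] at this
  rw [← this]
  congr 1
  exact (MvPolynomial.aeval_X v i).symm

theorem Complex.exists_derivations (m : ℕ) :
    ∃ x : Fin m ⊕ Fin m → ℂ, (∀ i, x i ≠ 0) ∧
      ∀ w : Fin m ⊕ Fin m → ℂ, ∃ d : Derivation ℤ ℂ ℂ, ∀ i, d (x i) = w i := by
  obtain ⟨s, hs⟩ := exists_isTranscendenceBasis ℚ ℂ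
  have hcard : Cardinal.mk ℂ = Cardinal.mk s :=
    IsAlgClosed.cardinal_eq_cardinal_transcendence_basis_of_aleph0_lt' (R := ℚ) _ hs
      (by simp) (by rw [Cardinal.mk_complex]; exact Cardinal.aleph0_lt_continuum)
  have : Infinite s := by
    rw [Cardinal.infinite_iff, ← hcard, Cardinal.mk_complex]
    exact Cardinal.aleph0_le_continuum
  obtain ⟨e⟩ : Nonempty (Fin m ⊕ Fin m ↪ s) :=
    ⟨(Fintype.equivFin (Fin m ⊕ Fin m)).toEmbedding.trans
      (Fin.valEmbedding.trans (Infinite.natEmbedding s))⟩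
  refine ⟨fun i => e i, fun i h => ?_, fun w => ?_⟩
  · exact hs.1.ne_zero (e i) h
  · obtain ⟨d, hd⟩ := hs.exists_derivation (Function.extend e w 0)
    exact ⟨d.restrictScalars ℤ, fun i => by simpa [e.injective.extend_apply] using hd (e i)⟩

/-- Derivations of a commutative ring over `ℤ`, with the canonical `ℤ`-algebra structure. -/
abbrev IntDerivation (R : Type*) [CommRing R] : Type _ :=
  Derivation ℤ R R

/-- The derivation of `R[X]` that applies `D` to every coefficient. -/
noncomputable def coeffDerivation {R : Type*} [CommRing R] (D : Derivation ℤ R R) :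
    IntDerivation (Polynomial R) :=
  @Differential.mapCoeffs R _ ⟨D⟩

section

open Polynomial

variable {R : Type*} [CommRing R] (D : Derivation ℤ R R)

theorem coeff_coeffDerivation (p : R[X]) (i : ℕ) :
    (coeffDerivation D p).coeff i = D (p.coeff i) := rfl

theorem natDegree_coeffDerivation_le (p : R[X]) :
    (coeffDerivation D p).natDegree ≤ p.natDegree :=
  natDegree_le_iff_coeff_eq_zero.mpr fun i hi => by
    rw [coeff_coeffDerivation, coeff_eq_zero_of_natDegree_lt hi, map_zero]

theorem evalRingHom_coeffDerivation {r : R} (hr : D r = 0) (p : R[X]) :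
    evalRingHom r (coeffDerivation D p) = D (evalRingHom r p) := by
  have hsupp : (coeffDerivation D p).natDegree < p.natDegree + 1 :=
    Nat.lt_succ_of_le (natDegree_coeffDerivation_le D p)
  rw [coe_evalRingHom, eval_eq_sum_range' hsupp, eval_eq_sum_range, map_sum]
  refine Finset.sum_congr rfl fun i _ => ?_
  simp [coeff_coeffDerivation, hr, mul_comm]

theorem exists_derivation_fractionField {F K Γ : Type*} [Field F] [Field K] [Algebra F[X] K]
    [IsFractionRing F[X] K] [LinearOrderedCommGroupWithZero Γ] (v : Valuation K Γ)
    (hv : ∀ p q : F[X], q ≠ 0 → p.natDegree ≤ q.natDegree →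
      v (algebraMap F[X] K p) ≤ v (algebraMap F[X] K q))
    (D : Derivation ℤ F F) :
    ∃ D' : Derivation ℤ K K,
      (∀ p : F[X], D' (algebraMap F[X] K p) = algebraMap F[X] K (coeffDerivation D p)) ∧
      ∀ a, v (D' a) ≤ v a := by
  have : Algebra.FormallyEtale F[X] K := .of_isLocalization (nonZeroDivisors F[X])
  obtain ⟨D', hD'⟩ := exists_derivation_extending ℤ F[X] K
    ((Algebra.linearMap F[X] K).compDer (coeffDerivation D))
  have hD : ∀ p : F[X], D' (algebraMap F[X] K p) =
      algebraMap F[X] K (coeffDerivation D p) := fun p => by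
    rw [hD']; rfl
  have hpoly : ∀ p : F[X], v (D' (algebraMap F[X] K p)) ≤ v (algebraMap F[X] K p) := fun p => by
    rw [hD]
    by_cases hp : p = 0
    · simp [hp]
    · exact hv _ _ hp (natDegree_coeffDerivation_le D p)
  refine ⟨D', hD, fun a => ?_⟩
  obtain ⟨p, q, hq, rfl⟩ := IsFractionRing.div_surjective (A := F[X]) a
  have hq0 : algebraMap F[X] K q ≠ 0 := IsFractionRing.to_map_ne_zero_of_mem_nonZeroDivisors hq
  set P := algebraMap F[X] K p
  set Q := algebraMap F[X] K q
  have hvQ : v Q ≠ 0 := (Valuation.ne_zero_iff v).mpr hq0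
  rw [Derivation.leibniz_div, smul_eq_mul, smul_eq_mul, smul_eq_mul, map_mul, map_div₀]
  have hnum : v (Q * D' P - P * D' Q) ≤ v P * v Q := by
    refine (Valuation.map_sub v _ _).trans (max_le ?_ ?_)
    · rw [map_mul, mul_comm]; exact mul_le_mul_left (hpoly p) _
    · rw [map_mul]; exact mul_le_mul_right (hpoly q) _
  calc v (Q⁻¹ ^ 2) * v (Q * D' P - P * D' Q) ≤ v (Q⁻¹ ^ 2) * (v P * v Q) :=
        mul_le_mul_right hnum _
    _ = v P / v Q := by
        rw [map_pow, map_inv₀]; field_simp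

theorem inftyValuation_algebraMap {F : Type*} [Field F] [DecidableEq (RatFunc F)] {p : F[X]}
    (hp : p ≠ 0) :
    RatFunc.inftyValuation F (algebraMap F[X] (RatFunc F) p) =
      WithZero.exp (p.natDegree : ℤ) := by
  rw [RatFunc.inftyValuation_apply, RatFunc.inftyValuation_of_nonzero, RatFunc.intDegree_polynomial]
  exact RatFunc.algebraMap_ne_zero hp

theorem inftyValuation_algebraMap_le {F : Type*} [Field F] [DecidableEq (RatFunc F)] (p q : F[X])
    (hq : q ≠ 0) (h : p.natDegree ≤ q.natDegree) :
    RatFunc.inftyValuation F (algebraMap F[X] (RatFunc F) p) ≤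
      RatFunc.inftyValuation F (algebraMap F[X] (RatFunc F) q) := by
  by_cases hp : p = 0
  · simp [hp]
  · rw [inftyValuation_algebraMap hp, inftyValuation_algebraMap hq, WithZero.exp_le_exp]
    exact_mod_cast h

theorem natDegree_eq_zero_of_inftyValuation_le_one {F : Type*} [Field F]
    [DecidableEq (RatFunc F)] {p : F[X]}
    (h : RatFunc.inftyValuation F (algebraMap F[X] (RatFunc F) p) ≤ 1) : p.natDegree = 0 := by
  by_cases hp : p = 0
  · simp [hp]
  · rw [inftyValuation_algebraMap hp, ← WithZero.exp_zero, WithZero.exp_le_exp] at h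
    exact_mod_cast le_antisymm h (by positivity)

end

section Extension

variable {n R S : Type*} [Fintype n] [DecidableEq n] [CommRing R] [CommRing S]

theorem map_derivation_mul {n R : Type*} [Fintype n] [CommRing R] (D : Derivation ℤ R R)
    (M N : Matrix n n R) :
    (M * N).map D = M.map D * N + M * N.map D := by
  ext i j
  simp only [map_apply, mul_apply, Matrix.add_apply, map_sum, Derivation.leibniz, smul_eq_mul,
    Finset.sum_add_distrib]
  rw [add_comm]
  congr 1
  exact Finset.sum_congr rfl fun k _ => mul_comm _ _

/-- The left logarithmic derivative `g⁻¹ Dg`. -/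
def leftLogDeriv (D : Derivation ℤ R R) (g : Matrix.SpecialLinearGroup n R) : Matrix n n R :=
  g⁻¹.1 * g.1.map D

/-- The right logarithmic derivative `Dg g⁻¹`. -/
def rightLogDeriv (D : Derivation ℤ R R) (g : Matrix.SpecialLinearGroup n R) : Matrix n n R :=
  g.1.map D * g⁻¹.1

theorem coe_inv_mul_coe (g : Matrix.SpecialLinearGroup n R) :
    g⁻¹.1 * g.1 = 1 := by
  rw [← Matrix.SpecialLinearGroup.coe_mul, inv_mul_cancel, Matrix.SpecialLinearGroup.coe_one]

theorem coe_mul_coe_inv (g : Matrix.SpecialLinearGroup n R) :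
    g.1 * g⁻¹.1 = 1 := by
  rw [← Matrix.SpecialLinearGroup.coe_mul, mul_inv_cancel, Matrix.SpecialLinearGroup.coe_one]

theorem leftLogDeriv_mul (D : Derivation ℤ R R) (g h : Matrix.SpecialLinearGroup n R) :
    leftLogDeriv D (g * h) = h⁻¹.1 * leftLogDeriv D g * h.1 + leftLogDeriv D h := by
  have : h⁻¹.1 * g⁻¹.1 * (g.1 * h.1.map D) =
      h⁻¹.1 * h.1.map D := by
    rw [Matrix.mul_assoc, ← Matrix.mul_assoc g⁻¹.1, coe_inv_mul_coe,
      Matrix.one_mul]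
  simp only [leftLogDeriv, _root_.mul_inv_rev, Matrix.SpecialLinearGroup.coe_mul,
    map_derivation_mul, Matrix.mul_add, this]
  simp only [Matrix.mul_assoc]

theorem rightLogDeriv_mul (D : Derivation ℤ R R) (g h : Matrix.SpecialLinearGroup n R) :
    rightLogDeriv D (g * h) = rightLogDeriv D g + g.1 * rightLogDeriv D h * g⁻¹.1 := by
  have : g.1.map D * h.1 * (h⁻¹.1 * g⁻¹.1) =
      g.1.map D * g⁻¹.1 := by
    rw [Matrix.mul_assoc, ← Matrix.mul_assoc h.1, coe_mul_coe_inv, Matrix.one_mul]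
  simp only [rightLogDeriv, _root_.mul_inv_rev, Matrix.SpecialLinearGroup.coe_mul,
    map_derivation_mul, Matrix.add_mul, this]
  simp only [Matrix.mul_assoc]

theorem leftLogDeriv_eq_zero {D : Derivation ℤ R R} {g : Matrix.SpecialLinearGroup n R}
    (hg : g.1.map D = 0) : leftLogDeriv D g = 0 := by
  rw [leftLogDeriv, hg, Matrix.mul_zero]

theorem rightLogDeriv_eq_zero {D : Derivation ℤ R R} {g : Matrix.SpecialLinearGroup n R}
    (hg : g.1.map D = 0) : rightLogDeriv D g = 0 := by
  rw [rightLogDeriv, hg, Matrix.zero_mul]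

theorem map_derivation_one (D : Derivation ℤ R R) :
    (1 : Matrix.SpecialLinearGroup n R).1.map D = 0 := by
  ext i j
  by_cases h : i = j <;> simp [h, one_apply]

/-- The cup product of the two logarithmic derivatives under the trace form. -/
def traceCocycle (D₁ D₂ : Derivation ℤ R R) (g h : Matrix.SpecialLinearGroup n R) : R :=
  trace (leftLogDeriv D₁ g * rightLogDeriv D₂ h)

variable (D₁ D₂ : Derivation ℤ R R)

theorem traceCocycle_assoc (g h k : Matrix.SpecialLinearGroup n R) :
    traceCocycle D₁ D₂ g h + traceCocycle D₁ D₂ (g * h) k =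
      traceCocycle D₁ D₂ h k + traceCocycle D₁ D₂ g (h * k) := by
  have : trace (h⁻¹.1 * leftLogDeriv D₁ g * h.1 * rightLogDeriv D₂ k) =
      trace (leftLogDeriv D₁ g * (h.1 * rightLogDeriv D₂ k * h⁻¹.1)) := by
    rw [Matrix.mul_assoc, Matrix.mul_assoc, trace_mul_comm]
    simp only [Matrix.mul_assoc]
  simp only [traceCocycle, leftLogDeriv_mul, rightLogDeriv_mul, Matrix.add_mul, Matrix.mul_add,
    trace_add, this]
  ring

theorem traceCocycle_of_left {g : Matrix.SpecialLinearGroup n R} (hg : g.1.map D₁ = 0)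
    (h : Matrix.SpecialLinearGroup n R) : traceCocycle D₁ D₂ g h = 0 := by
  rw [traceCocycle, leftLogDeriv_eq_zero hg, Matrix.zero_mul, trace_zero]

theorem traceCocycle_of_right {h : Matrix.SpecialLinearGroup n R} (hh : h.1.map D₂ = 0)
    (g : Matrix.SpecialLinearGroup n R) : traceCocycle D₁ D₂ g h = 0 := by
  rw [traceCocycle, rightLogDeriv_eq_zero hh, Matrix.mul_zero, trace_zero]

theorem traceCocycle_one_left (g : Matrix.SpecialLinearGroup n R) : traceCocycle D₁ D₂ 1 g = 0 :=
  traceCocycle_of_left D₁ D₂ (map_derivation_one D₁) g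

/-- The central extension of `SL(n,R)` by the additive group of `R` defined by
`traceCocycle D₁ D₂`. -/
@[ext]
structure TraceExtension (n : Type*) {R : Type*} [Fintype n] [DecidableEq n] [CommRing R]
    (D₁ D₂ : Derivation ℤ R R) where
  /-- The underlying matrix. -/
  mat : Matrix.SpecialLinearGroup n R
  /-- The central coordinate. -/
  cent : R

namespace TraceExtension

variable {D₁ D₂}

instance : Mul (TraceExtension n D₁ D₂) :=
  ⟨fun x y => ⟨x.mat * y.mat, x.cent + y.cent + traceCocycle D₁ D₂ x.mat y.mat⟩⟩

instance : One (TraceExtension n D₁ D₂) := ⟨⟨1, 0⟩⟩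

instance : Inv (TraceExtension n D₁ D₂) :=
  ⟨fun x => ⟨x.mat⁻¹, -x.cent - traceCocycle D₁ D₂ x.mat⁻¹ x.mat⟩⟩

@[simp] theorem mat_mul (x y : TraceExtension n D₁ D₂) : (x * y).mat = x.mat * y.mat := rfl

theorem cent_mul (x y : TraceExtension n D₁ D₂) :
    (x * y).cent = x.cent + y.cent + traceCocycle D₁ D₂ x.mat y.mat := rfl

@[simp] theorem mat_one : (1 : TraceExtension n D₁ D₂).mat = 1 := rfl

@[simp] theorem cent_one : (1 : TraceExtension n D₁ D₂).cent = 0 := rfl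

@[simp] theorem mat_inv (x : TraceExtension n D₁ D₂) : x⁻¹.mat = x.mat⁻¹ := rfl

theorem cent_inv (x : TraceExtension n D₁ D₂) :
    x⁻¹.cent = -x.cent - traceCocycle D₁ D₂ x.mat⁻¹ x.mat := rfl

instance : Group (TraceExtension n D₁ D₂) :=
  Group.ofLeftAxioms
    (fun x y z => TraceExtension.ext (mul_assoc _ _ _) (by
      simp only [cent_mul, mat_mul]
      linear_combination traceCocycle_assoc D₁ D₂ x.mat y.mat z.mat))
    (fun x => TraceExtension.ext (one_mul _) (by
      simp [cent_mul, traceCocycle_one_left]))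
    (fun x => TraceExtension.ext (inv_mul_cancel _) (by
      simp [cent_mul, cent_inv]; ring))

variable (D₁ D₂) in
/-- The projection to `SL(n,R)`. -/
def matHom : TraceExtension n D₁ D₂ →* Matrix.SpecialLinearGroup n R where
  toFun := mat
  map_one' := rfl
  map_mul' _ _ := rfl

open scoped commutatorElement in
theorem commutatorElement_eq {x y : TraceExtension n D₁ D₂} (h : x.mat * y.mat = y.mat * x.mat) :
    ⁅x, y⁆ = ⟨1, traceCocycle D₁ D₂ x.mat y.mat - traceCocycle D₁ D₂ y.mat x.mat⟩ := by
  have : x * y = ⟨1, traceCocycle D₁ D₂ x.mat y.mat - traceCocycle D₁ D₂ y.mat x.mat⟩ * (y * x) :=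
    TraceExtension.ext (by simp [h]) (by
      simp only [cent_mul, mat_mul, traceCocycle_one_left]; ring)
  rw [commutatorElement_def, mul_assoc, ← _root_.mul_inv_rev, this, mul_inv_cancel_right]

theorem cent_mul_of_mat_eq_one {x y : TraceExtension n D₁ D₂} (hx : x.mat = 1) :
    (x * y).cent = x.cent + y.cent := by
  rw [cent_mul, hx, traceCocycle_one_left, add_zero]

theorem prod_of_mat_eq_one (L : List (TraceExtension n D₁ D₂)) (h : ∀ x ∈ L, x.mat = 1) :
    L.prod = ⟨1, (L.map cent).sum⟩ := by
  induction L with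
  | nil => rfl
  | cons x L ih =>
    rw [List.prod_cons, ih fun y hy => h y (List.mem_cons_of_mem _ hy)]
    have hx := h x List.mem_cons_self
    exact TraceExtension.ext (by simp [hx]) (by simp [cent_mul_of_mat_eq_one hx])

theorem conj_of_const {w : Matrix.SpecialLinearGroup n R} (h₁ : w.1.map D₁ = 0)
    (h₂ : w.1.map D₂ = 0) (x : TraceExtension n D₁ D₂) :
    (⟨w, 0⟩ : TraceExtension n D₁ D₂) * x = ⟨w * x.mat * w⁻¹, x.cent⟩ * ⟨w, 0⟩ :=
  TraceExtension.ext (by simp) (by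
    simp [cent_mul, traceCocycle_of_left D₁ D₂ h₁, traceCocycle_of_right D₁ D₂ h₂])

theorem leftLogDeriv_map (f : R →+* S) {D : Derivation ℤ R R} {D' : Derivation ℤ S S}
    (h : ∀ a, f (D a) = D' (f a)) (g : Matrix.SpecialLinearGroup n R) :
    leftLogDeriv D' (Matrix.SpecialLinearGroup.map f g) = f.mapMatrix (leftLogDeriv D g) := by
  rw [leftLogDeriv, leftLogDeriv, map_mul, ← map_inv]
  congr 1
  ext i j
  simp [h]

theorem rightLogDeriv_map (f : R →+* S) {D : Derivation ℤ R R} {D' : Derivation ℤ S S}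
    (h : ∀ a, f (D a) = D' (f a)) (g : Matrix.SpecialLinearGroup n R) :
    rightLogDeriv D' (Matrix.SpecialLinearGroup.map f g) = f.mapMatrix (rightLogDeriv D g) := by
  rw [rightLogDeriv, rightLogDeriv, map_mul, ← map_inv]
  congr 1
  ext i j
  simp [h]

/-- The homomorphism of extensions induced by a ring homomorphism that commutes with the
derivations. -/
def map (f : R →+* S) {D₁' D₂' : Derivation ℤ S S} (h₁ : ∀ a, f (D₁ a) = D₁' (f a))
    (h₂ : ∀ a, f (D₂ a) = D₂' (f a)) : TraceExtension n D₁ D₂ →* TraceExtension n D₁' D₂' where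
  toFun x := ⟨Matrix.SpecialLinearGroup.map f x.mat, f x.cent⟩
  map_one' := TraceExtension.ext (map_one _) (map_zero f)
  map_mul' x y := TraceExtension.ext (map_mul _ _ _) (by
    simp only [cent_mul, map_add, traceCocycle, leftLogDeriv_map f h₁, rightLogDeriv_map f h₂,
      RingHom.mapMatrix_apply]
    simp [trace, mul_apply])

end TraceExtension

end Extension

section Elementary

variable {n : ℕ} {R S : Type*} [CommRing R] [CommRing S]

theorem coe_elemT {i j : Fin n} (h : i ≠ j) (a : R) : (elemT i j h a).1 = 1 + single i j a := rfl

theorem elemT_mul_elemT {i j : Fin n} (h : i ≠ j) (a b : R) :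
    elemT i j h a * elemT i j h b = elemT i j h (a + b) :=
  Subtype.ext (transvection_mul_transvection_same (R := R) i j h a b)

theorem elemT_zero {i j : Fin n} (h : i ≠ j) : elemT i j h (0 : R) = 1 :=
  Subtype.ext (transvection_zero (R := R) i j)

theorem elemT_inv {i j : Fin n} (h : i ≠ j) (a : R) :
    (elemT i j h a)⁻¹ = elemT i j h (-a) := by
  rw [inv_eq_iff_mul_eq_one, elemT_mul_elemT, add_neg_cancel, elemT_zero]

theorem map_elemT (f : R →+* S) {i j : Fin n} (h : i ≠ j) (a : R) :
    Matrix.SpecialLinearGroup.map f (elemT i j h a) = elemT i j h (f a) := by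
  ext k l
  change f (((1 : Matrix (Fin n) (Fin n) R) + single i j a) k l) =
    ((1 : Matrix (Fin n) (Fin n) S) + single i j (f a)) k l
  simp only [Matrix.add_apply, map_add, Matrix.one_apply, Matrix.single_apply, apply_ite f,
    map_zero, map_one]

theorem map_derivation_elemT (D : Derivation ℤ R R) {i j : Fin n} (h : i ≠ j) (a : R) :
    (elemT i j h a).1.map D = single i j (D a) := by
  ext k l
  simp only [elemT, transvection, map_apply, Matrix.add_apply, map_add, Matrix.one_apply,
    Matrix.single_apply, apply_ite D, map_zero, Derivation.map_one_eq_zero, ite_self, zero_add]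

theorem leftLogDeriv_elemT (D : Derivation ℤ R R) {i j : Fin n} (h : i ≠ j) (a : R) :
    leftLogDeriv D (elemT i j h a) = single i j (D a) := by
  rw [leftLogDeriv, map_derivation_elemT, elemT_inv]
  simp [elemT, transvection, Matrix.add_mul, h.symm]

theorem rightLogDeriv_elemT (D : Derivation ℤ R R) {i j : Fin n} (h : i ≠ j) (a : R) :
    rightLogDeriv D (elemT i j h a) = single i j (D a) := by
  rw [rightLogDeriv, map_derivation_elemT, elemT_inv]
  simp [elemT, transvection, Matrix.mul_add, h.symm]

theorem traceCocycle_elemT (D₁ D₂ : Derivation ℤ R R) {i j : Fin n} (h : i ≠ j) (a : R)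
    (g : Matrix.SpecialLinearGroup (Fin n) R) :
    traceCocycle D₁ D₂ (elemT i j h a) g = D₁ a * rightLogDeriv D₂ g j i := by
  rw [traceCocycle, leftLogDeriv_elemT, trace_single_mul, smul_eq_mul]

/-- The elementary generator of the extension above `elemT i j h a`. -/
def TraceExtension.elem {D₁ D₂ : Derivation ℤ R R} (i j : Fin n) (h : i ≠ j) (a : R) :
    TraceExtension (Fin n) D₁ D₂ :=
  ⟨elemT i j h a, 0⟩

variable (D₁ D₂ : Derivation ℤ R R)

theorem TraceExtension.elem_inv {i j : Fin n} (h : i ≠ j) (a : R) :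
    (elem i j h a : TraceExtension (Fin n) D₁ D₂)⁻¹ = elem i j h (-a) :=
  TraceExtension.ext (elemT_inv h a) (by
    simp [cent_inv, elem, elemT_inv, traceCocycle_elemT, rightLogDeriv_elemT, h])

/-- The subgroup of the extension generated by the lifts of the elementary transvections. -/
def TraceExtension.elementary (n : ℕ) : Subgroup (TraceExtension (Fin n) D₁ D₂) :=
  Subgroup.closure {x | ∃ i j, ∃ h : i ≠ j, ∃ a, x = elem i j h a}

/-- A representative of the reflection exchanging the coordinates `i` and `j`. -/
def reflT (R : Type*) [CommRing R] {i j : Fin n} (h : i ≠ j) :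
    Matrix.SpecialLinearGroup (Fin n) R :=
  elemT i j h 1 * elemT j i h.symm (-1) * elemT i j h 1

theorem map_derivation_reflT (D : Derivation ℤ R R) {i j : Fin n} (h : i ≠ j) :
    (reflT R h).1.map D = 0 := by
  simp only [reflT, Matrix.SpecialLinearGroup.coe_mul, map_derivation_mul, map_derivation_elemT,
    map_neg, Derivation.map_one_eq_zero, neg_zero, single_zero, Matrix.mul_zero, Matrix.zero_mul,
    add_zero]

end Elementary

namespace TraceExtension

section Valuation

variable {n K Γ : Type*} [Fintype n] [DecidableEq n] [Field K] [LinearOrderedCommGroupWithZero Γ]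
  (v : Valuation K Γ) {D D₁ D₂ : Derivation ℤ K K}

theorem inv_mem_matrix (O : Subring K) {g : Matrix.SpecialLinearGroup n K} (hg : g.1 ∈ O.matrix) :
    g⁻¹.1 ∈ O.matrix := by
  intro i j
  rw [Matrix.SpecialLinearGroup.coe_inv, adjugate_apply, det_apply]
  refine O.sum_mem fun σ _ => zsmul_mem (O.prod_mem fun k _ => ?_) _
  rw [updateRow_apply]
  split_ifs
  · rw [Pi.single_apply]
    split_ifs
    exacts [O.one_mem, O.zero_mem]
  · exact hg _ _

theorem map_mem_matrix (h : ∀ a, v (D a) ≤ v a) {M : Matrix n n K}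
    (hM : M ∈ v.integer.matrix) : M.map D ∈ v.integer.matrix :=
  fun i j => (h _).trans (hM i j)

/-- The elements of the extension whose coordinates are all integral. -/
def integral (h₁ : ∀ a, v (D₁ a) ≤ v a) (h₂ : ∀ a, v (D₂ a) ≤ v a) :
    Subgroup (TraceExtension n D₁ D₂) :=
  have key : ∀ g h : Matrix.SpecialLinearGroup n K, g.1 ∈ v.integer.matrix →
      h.1 ∈ v.integer.matrix → traceCocycle D₁ D₂ g h ∈ v.integer := fun _ _ hg hh =>
    v.integer.sum_mem fun i _ => v.integer.matrix.mul_mem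
      (v.integer.matrix.mul_mem (inv_mem_matrix _ hg) (map_mem_matrix v h₁ hg))
      (v.integer.matrix.mul_mem (map_mem_matrix v h₂ hh) (inv_mem_matrix _ hh)) i i
  { carrier := {x | x.mat.1 ∈ v.integer.matrix ∧ x.cent ∈ v.integer}
    mul_mem' := fun hx hy => ⟨v.integer.matrix.mul_mem hx.1 hy.1,
      v.integer.add_mem (v.integer.add_mem hx.2 hy.2) (key _ _ hx.1 hy.1)⟩
    one_mem' := ⟨v.integer.matrix.one_mem, v.integer.zero_mem⟩
    inv_mem' := fun hx => ⟨inv_mem_matrix _ hx.1,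
      v.integer.sub_mem (v.integer.neg_mem hx.2) (key _ _ (inv_mem_matrix _ hx.1) hx.1)⟩ }

theorem mul_apply_self_of_isUpperTriangular {n : Type*} [Fintype n] [LinearOrder n]
    {M N : Matrix n n K} (hM : M.IsUpperTriangular) (hN : N.IsUpperTriangular) (i : n) :
    (M * N) i i = M i i * N i i := by
  rw [mul_apply]
  refine Finset.sum_eq_single i (fun k _ hk => ?_) (by simp)
  rcases lt_or_gt_of_ne hk with h | h
  · rw [hM h, zero_mul]
  · rw [hN h, mul_zero]

theorem isUpperTriangular_inv [LinearOrder n] {g : Matrix.SpecialLinearGroup n K}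
    (hg : g.1.IsUpperTriangular) : g⁻¹.1.IsUpperTriangular := by
  have : Invertible g.1 := ⟨g⁻¹.1, coe_inv_mul_coe g, coe_mul_coe_inv g⟩
  have h := blockTriangular_inv_of_blockTriangular hg
  rwa [inv_eq_left_inv (coe_inv_mul_coe g)] at h

theorem isUpperTriangular_map {n : Type*} [LinearOrder n] {M : Matrix n n K}
    (hM : M.IsUpperTriangular) : (M.map D).IsUpperTriangular := fun i j hij => by
  rw [map_apply, hM hij, map_zero]

/-- The elements of the extension with upper triangular matrix and integral central
coordinate. -/
def borel [LinearOrder n] (h₁ : ∀ a, v (D₁ a) ≤ v a) (h₂ : ∀ a, v (D₂ a) ≤ v a) :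
    Subgroup (TraceExtension n D₁ D₂) :=
  have diag : ∀ g : Matrix.SpecialLinearGroup n K, g.1.IsUpperTriangular → ∀ i,
      g⁻¹.1 i i * g.1 i i = 1 := fun g hg i => by
    rw [← mul_apply_self_of_isUpperTriangular (isUpperTriangular_inv hg) hg, coe_inv_mul_coe,
      one_apply_eq]
  have integral : ∀ D : Derivation ℤ K K, (∀ a, v (D a) ≤ v a) →
      ∀ g : Matrix.SpecialLinearGroup n K, g.1.IsUpperTriangular → ∀ i,
      g⁻¹.1 i i * D (g.1 i i) ∈ v.integer := fun D h g hg i => by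
    rw [Valuation.mem_integer_iff, map_mul]
    refine (mul_le_mul_right (h _) _).trans ?_
    rw [← map_mul, diag g hg, map_one]
  have key : ∀ g h : Matrix.SpecialLinearGroup n K, g.1.IsUpperTriangular →
      h.1.IsUpperTriangular → traceCocycle D₁ D₂ g h ∈ v.integer := fun g h hg hh => by
    refine v.integer.sum_mem fun i _ => ?_
    have hg' := isUpperTriangular_map (D := D₁) hg
    have hh' := isUpperTriangular_map (D := D₂) hh
    rw [diag_apply, leftLogDeriv, rightLogDeriv, mul_apply_self_of_isUpperTriangular
      ((isUpperTriangular_inv hg).mul hg') (hh'.mul (isUpperTriangular_inv hh)),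
      mul_apply_self_of_isUpperTriangular (isUpperTriangular_inv hg) hg',
      mul_apply_self_of_isUpperTriangular hh' (isUpperTriangular_inv hh), mul_comm (h.1.map _ _ _)]
    exact v.integer.mul_mem (integral D₁ h₁ g hg i) (integral D₂ h₂ h hh i)
  { carrier := {x | x.mat.1.IsUpperTriangular ∧ x.cent ∈ v.integer}
    mul_mem' := fun hx hy => ⟨hx.1.mul hy.1,
      v.integer.add_mem (v.integer.add_mem hx.2 hy.2) (key _ _ hx.1 hy.1)⟩
    one_mem' := ⟨blockTriangular_one, v.integer.zero_mem⟩
    inv_mem' := fun hx => ⟨isUpperTriangular_inv hx.1,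
      v.integer.sub_mem (v.integer.neg_mem hx.2) (key _ _ (isUpperTriangular_inv hx.1) hx.1)⟩ }

end Valuation

end TraceExtension

/-- The elements that stabilize a subset of a monoid under right multiplication. -/
def rightStabilizer {G : Type*} [Monoid G] (T : Set G) : Submonoid G where
  carrier := {x | ∀ t ∈ T, t * x ∈ T}
  mul_mem' hx hy t ht := by
    rw [← mul_assoc]
    exact hy _ (hx t ht)
  one_mem' t ht := by rwa [mul_one]

namespace TraceExtension

open scoped Pointwise

section Valuation

variable {n : ℕ} {K Γ : Type*} [Field K] [LinearOrderedCommGroupWithZero Γ]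
  (v : Valuation K Γ) {D₁ D₂ : Derivation ℤ K K}

theorem elemT_mem_matrix {i j : Fin n} (h : i ≠ j) {a : K} (ha : v a ≤ 1) :
    (elemT i j h a).1 ∈ v.integer.matrix := fun k l => by
  simp only [elemT, transvection, Matrix.add_apply, Matrix.one_apply, Matrix.single_apply]
  refine v.integer.add_mem ?_ ?_ <;> split_ifs
  exacts [v.integer.one_mem, v.integer.zero_mem, ha, v.integer.zero_mem]

theorem reflT_mem_matrix {i j : Fin n} (h : i ≠ j) : (reflT K h).1 ∈ v.integer.matrix :=
  v.integer.matrix.mul_mem (v.integer.matrix.mul_mem (elemT_mem_matrix v h (by simp))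
    (elemT_mem_matrix v h.symm (by simp))) (elemT_mem_matrix v h (by simp))

theorem rightLogDeriv_cell (D : Derivation ℤ K K) {i j : Fin n} (h : i ≠ j) (x y : K) :
    rightLogDeriv D (elemT j i h.symm y * elemT i j h x * reflT K h) i j = D x := by
  rw [rightLogDeriv_mul, rightLogDeriv_mul, rightLogDeriv_eq_zero (map_derivation_reflT D h),
    rightLogDeriv_elemT, rightLogDeriv_elemT, elemT_inv]
  simp [elemT, transvection, Matrix.mul_add, Matrix.add_mul, h, h.symm]

variable (n) (h₁ : ∀ a, v (D₁ a) ≤ v a) (h₂ : ∀ a, v (D₂ a) ≤ v a)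

/-- The products of an integral element and an element of the Borel subgroup. -/
def cells : Set (TraceExtension (Fin n) D₁ D₂) :=
  (integral (n := Fin n) v h₁ h₂).carrier * (borel (n := Fin n) v h₁ h₂).carrier

variable {n}

theorem borel_le_rightStabilizer :
    (borel v h₁ h₂).toSubmonoid ≤ rightStabilizer (cells n v h₁ h₂) := by
  rintro b' hb' _ ⟨k, hk, b, hb, rfl⟩
  exact ⟨k, hk, b * b', mul_mem hb hb', (mul_assoc _ _ _).symm⟩

theorem elem_mem_rightStabilizer {i j : Fin n} (hij : i < j) (a : K) :
    elem i j hij.ne a ∈ rightStabilizer (cells n v h₁ h₂) :=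
  borel_le_rightStabilizer v h₁ h₂
    ⟨blockTriangular_transvection (b := id) hij.le a, v.integer.zero_mem⟩

theorem elem_mul_reflT_mem_cells {i j : Fin n} (h : i ≠ j)
    (hcell : ∀ x : K, x ≠ 0 →
      (elemT j i h.symm (-x⁻¹) * elemT i j h x * reflT K h).1.IsUpperTriangular) (x : K) :
    elem i j h x * ⟨reflT K h, 0⟩ ∈ cells n v h₁ h₂ := by
  by_cases hx : v x ≤ 1
  · refine ⟨_, (integral v h₁ h₂).mul_mem ?_ ?_, 1, (borel v h₁ h₂).one_mem, mul_one _⟩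
    · exact ⟨elemT_mem_matrix v h hx, v.integer.zero_mem⟩
    · exact ⟨reflT_mem_matrix v h, v.integer.zero_mem⟩
  · have hx0 : x ≠ 0 := by
      rintro rfl
      simp at hx
    have hx' : v x⁻¹ ≤ 1 := by
      rw [map_inv₀]
      exact inv_le_one_of_one_le₀ (not_le.mp hx).le
    refine ⟨elem j i h.symm x⁻¹, ⟨elemT_mem_matrix v h.symm hx', v.integer.zero_mem⟩,
      ⟨elemT j i h.symm (-x⁻¹) * elemT i j h x * reflT K h, -(D₁ x⁻¹ * D₂ x)⟩,
      ⟨hcell x hx0, v.integer.neg_mem ?_⟩, TraceExtension.ext ?_ ?_⟩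
    · rw [Valuation.mem_integer_iff, map_mul]
      refine (mul_le_mul' (h₁ _) (h₂ _)).trans ?_
      rw [← map_mul, inv_mul_cancel₀ hx0, map_one]
    · simp only [mat_mul, elem, ← mul_assoc, elemT_mul_elemT, add_neg_cancel, elemT_zero, one_mul]
    · simp only [cent_mul, elem, traceCocycle_elemT, rightLogDeriv_cell,
        traceCocycle_of_right D₁ D₂ (map_derivation_reflT D₂ h)]
      ring

theorem reflT_mem_rightStabilizer {i j : Fin n} (hij : i < j)
    (hcell : ∀ x : K, x ≠ 0 →
      (elemT j i hij.ne' (-x⁻¹) * elemT i j hij.ne x * reflT K hij.ne).1.IsUpperTriangular)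
    (hconj : ∀ b : Matrix.SpecialLinearGroup (Fin n) K, b.1.IsUpperTriangular →
      ∃ x : K, ((reflT K hij.ne)⁻¹ * (elemT i j hij.ne (-x) * b) *
        reflT K hij.ne).1.IsUpperTriangular) :
    ⟨reflT K hij.ne, 0⟩ ∈ rightStabilizer (cells n v h₁ h₂) := by
  rintro _ ⟨k, hk, b, hb, rfl⟩
  obtain ⟨x, hx⟩ := hconj b.mat hb.1
  have hb' : (elem i j hij.ne x)⁻¹ * b ∈ borel v h₁ h₂ := mul_mem (inv_mem
    ⟨blockTriangular_transvection (b := id) hij.le x, v.integer.zero_mem⟩) hb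
  obtain ⟨c, hc⟩ : ∃ c, c = (elem i j hij.ne x)⁻¹ * b := ⟨_, rfl⟩
  rw [← hc] at hb'
  have hcmat : c.mat = elemT i j hij.ne (-x) * b.mat := by
    rw [hc, elem_inv]; rfl
  have hconst := conj_of_const (map_derivation_reflT D₁ hij.ne) (map_derivation_reflT D₂ hij.ne)
    (⟨(reflT K hij.ne)⁻¹ * c.mat * reflT K hij.ne, c.cent⟩ : TraceExtension (Fin n) D₁ D₂)
  simp only [mul_assoc, mul_inv_cancel, mul_one, mul_inv_cancel_left] at hconst
  obtain ⟨k', hk', b', hb'', h⟩ := elem_mul_reflT_mem_cells v h₁ h₂ hij.ne hcell x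
  refine ⟨k * k', (integral v h₁ h₂).mul_mem hk hk',
    b' * ⟨(reflT K hij.ne)⁻¹ * (c.mat * reflT K hij.ne), c.cent⟩,
    (borel v h₁ h₂).mul_mem hb'' ⟨?_, hb'.2⟩, ?_⟩
  · rw [← mul_assoc, hcmat]
    exact hx
  · have hbc : b = elem i j hij.ne x * c := by rw [hc, mul_inv_cancel_left]
    change k * k' * (b' * _) = k * b * _
    change k' * b' = _ at h
    rw [mul_assoc, ← mul_assoc k', h, mul_assoc, hconst, hbc, mul_assoc k, mul_assoc]

theorem cent_le_one_of_mem_cells {x : TraceExtension (Fin n) D₁ D₂} (hx : x ∈ cells n v h₁ h₂)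
    (hmat : x.mat = 1) : v x.cent ≤ 1 := by
  obtain ⟨k, hk, b, hb, rfl⟩ := hx
  have hb' : b.mat = k.mat⁻¹ := (inv_eq_of_mul_eq_one_right hmat).symm
  refine ((integral v h₁ h₂).mul_mem hk ?_).2
  refine ⟨?_, hb.2⟩
  rw [hb']
  exact inv_mem_matrix _ hk.1

theorem pow_four_eq_one {w : Matrix.SpecialLinearGroup (Fin n) K} (hw : w ^ 4 = 1)
    (h₁ : w.1.map D₁ = 0) : (⟨w, 0⟩ : TraceExtension (Fin n) D₁ D₂) ^ 4 = 1 := by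
  have h : ∀ k : ℕ, (⟨w, 0⟩ : TraceExtension (Fin n) D₁ D₂) ^ k = ⟨w ^ k, 0⟩ := fun k => by
    induction k with
    | zero => rfl
    | succ k ih =>
      rw [pow_succ', ih]
      exact TraceExtension.ext (by simp [pow_succ']) (by
        simp [cent_mul, traceCocycle_of_left D₁ D₂ h₁])
  rw [h, hw]
  rfl

theorem conj_mem_rightStabilizer {w : Matrix.SpecialLinearGroup (Fin n) K} (hw : w ^ 4 = 1)
    (hw₁ : w.1.map D₁ = 0) (hw₂ : w.1.map D₂ = 0)
    {T : Set (TraceExtension (Fin n) D₁ D₂)} (hwT : ⟨w, 0⟩ ∈ rightStabilizer T)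
    {x y : Matrix.SpecialLinearGroup (Fin n) K} (h : y * w = w * x)
    (hx : (⟨x, 0⟩ : TraceExtension (Fin n) D₁ D₂) ∈ rightStabilizer T) :
    ⟨y, 0⟩ ∈ rightStabilizer T := by
  have h4 := pow_four_eq_one (D₂ := D₂) hw hw₁
  have hconj := conj_of_const hw₁ hw₂ (⟨x, 0⟩ : TraceExtension (Fin n) D₁ D₂)
  have hy : w * x * w⁻¹ = y := by rw [← h, mul_inv_cancel_right]
  simp only [hy] at hconj
  have : (⟨y, 0⟩ : TraceExtension (Fin n) D₁ D₂) = ⟨w, 0⟩ * ⟨x, 0⟩ * ⟨w, 0⟩ ^ 3 := by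
    rw [hconj, mul_assoc, ← pow_succ', h4, mul_one]
  rw [this]
  exact mul_mem (mul_mem hwT hx) (pow_mem hwT 3)

end Valuation

section Rank

variable {K Γ : Type*} [Field K] [LinearOrderedCommGroupWithZero Γ]
  (v : Valuation K Γ) {D₁ D₂ : Derivation ℤ K K}
  (h₁ : ∀ a, v (D₁ a) ≤ v a) (h₂ : ∀ a, v (D₂ a) ≤ v a)

theorem coe_reflT_zero_one :
    (reflT K (zero_ne_one : (0 : Fin 3) ≠ 1)).1 = !![0, 1, 0; -1, 0, 0; 0, 0, 1] := by
  simp only [reflT, Matrix.SpecialLinearGroup.coe_mul, coe_elemT]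
  ext i j
  fin_cases i <;> fin_cases j <;>
    simp [mul_apply, Fin.sum_univ_three, single_apply, one_apply]

theorem coe_reflT_one_two :
    (reflT K (by decide : (1 : Fin 3) ≠ 2)).1 = !![1, 0, 0; 0, 0, 1; 0, -1, 0] := by
  simp only [reflT, Matrix.SpecialLinearGroup.coe_mul, coe_elemT]
  ext i j
  fin_cases i <;> fin_cases j <;>
    simp [mul_apply, Fin.sum_univ_three, single_apply, one_apply]

theorem ne_zero_of_isUpperTriangular {n : Type*} [Fintype n] [LinearOrder n]
    {b : Matrix.SpecialLinearGroup n K} (hb : b.1.IsUpperTriangular) (i : n) : b.1 i i ≠ 0 := by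
  have h : b.1.det = 1 := b.2
  rw [det_of_isUpperTriangular hb] at h
  intro hi
  rw [Finset.prod_eq_zero (f := fun i => b.1 i i) (Finset.mem_univ i) hi] at h
  exact zero_ne_one h

theorem reflT_zero_one_mem :
    ⟨reflT K zero_ne_one, 0⟩ ∈ rightStabilizer (cells 3 v h₁ h₂) := by
  refine reflT_mem_rightStabilizer v h₁ h₂ (by decide : (0 : Fin 3) < 1) (fun x hx => ?_)
    fun b hb => ?_
  · simp only [Matrix.SpecialLinearGroup.coe_mul, coe_reflT_zero_one, coe_elemT]
    intro i j hij
    fin_cases i <;> fin_cases j <;>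
      simp_all [mul_apply, Fin.sum_univ_three, single_apply, one_apply]
  · refine ⟨b.1 0 1 / b.1 1 1, ?_⟩
    have h10 : b.1 1 0 = 0 := hb (by decide : (0 : Fin 3) < 1)
    have h20 : b.1 2 0 = 0 := hb (by decide : (0 : Fin 3) < 2)
    have h21 : b.1 2 1 = 0 := hb (by decide : (1 : Fin 3) < 2)
    have h11 := ne_zero_of_isUpperTriangular hb 1
    simp only [Matrix.SpecialLinearGroup.coe_mul, Matrix.SpecialLinearGroup.coe_inv,
      coe_reflT_zero_one, coe_elemT, adjugate_fin_three_of]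
    intro i j hij
    fin_cases i <;> fin_cases j <;>
      simp_all [vecMul, dotProduct, mul_apply, Fin.sum_univ_three, single_apply, one_apply]

theorem reflT_one_two_mem :
    ⟨reflT K (by decide : (1 : Fin 3) ≠ 2), 0⟩ ∈ rightStabilizer (cells 3 v h₁ h₂) := by
  refine reflT_mem_rightStabilizer v h₁ h₂ (by decide : (1 : Fin 3) < 2) (fun x hx => ?_)
    fun b hb => ?_
  · simp only [Matrix.SpecialLinearGroup.coe_mul, coe_reflT_one_two, coe_elemT]
    intro i j hij
    fin_cases i <;> fin_cases j <;>
      simp_all [mul_apply, Fin.sum_univ_three, single_apply, one_apply]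
  · refine ⟨b.1 1 2 / b.1 2 2, ?_⟩
    have h10 : b.1 1 0 = 0 := hb (by decide : (0 : Fin 3) < 1)
    have h20 : b.1 2 0 = 0 := hb (by decide : (0 : Fin 3) < 2)
    have h21 : b.1 2 1 = 0 := hb (by decide : (1 : Fin 3) < 2)
    have h22 := ne_zero_of_isUpperTriangular hb 2
    simp only [Matrix.SpecialLinearGroup.coe_mul, Matrix.SpecialLinearGroup.coe_inv,
      coe_reflT_one_two, coe_elemT, adjugate_fin_three_of]
    intro i j hij
    fin_cases i <;> fin_cases j <;>
      simp_all [vecMul, dotProduct, mul_apply, Fin.sum_univ_three, single_apply, one_apply]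

theorem elem_mem_rightStabilizer_three {i j : Fin 3} (h : i ≠ j) (a : K) :
    elem i j h a ∈ rightStabilizer (cells 3 v h₁ h₂) := by
  rcases lt_or_gt_of_ne h with hij | hij
  · exact elem_mem_rightStabilizer v h₁ h₂ hij a
  have w01 : reflT K (zero_ne_one : (0 : Fin 3) ≠ 1) ^ 4 = 1 := by
    ext i j
    rw [Matrix.SpecialLinearGroup.coe_pow, coe_reflT_zero_one]
    fin_cases i <;> fin_cases j <;> simp [pow_succ, mul_apply, Fin.sum_univ_three]
  have w12 : reflT K (by decide : (1 : Fin 3) ≠ 2) ^ 4 = 1 := by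
    ext i j
    rw [Matrix.SpecialLinearGroup.coe_pow, coe_reflT_one_two]
    fin_cases i <;> fin_cases j <;> simp [pow_succ, mul_apply, Fin.sum_univ_three]
  have c01 := fun {x y} => conj_mem_rightStabilizer w01 (map_derivation_reflT D₁ _)
    (map_derivation_reflT D₂ _) (reflT_zero_one_mem v h₁ h₂) (x := x) (y := y)
  have c12 := fun {x y} => conj_mem_rightStabilizer w12 (map_derivation_reflT D₁ _)
    (map_derivation_reflT D₂ _) (reflT_one_two_mem v h₁ h₂) (x := x) (y := y)
  have e10 : ∀ a : K, elem 1 0 (by decide) a ∈ rightStabilizer (cells 3 v h₁ h₂) := fun a => by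
    refine c01 (x := elemT 0 1 (by decide) (-a)) ?_ (elem_mem_rightStabilizer v h₁ h₂ (by decide) _)
    apply Subtype.ext
    simp only [Matrix.SpecialLinearGroup.coe_mul, coe_reflT_zero_one, coe_elemT]
    ext i j
    fin_cases i <;> fin_cases j <;>
      simp [mul_apply, Fin.sum_univ_three, single_apply, one_apply]
  have e21 : ∀ a : K, elem 2 1 (by decide) a ∈ rightStabilizer (cells 3 v h₁ h₂) := fun a => by
    refine c12 (x := elemT 1 2 (by decide) (-a)) ?_ (elem_mem_rightStabilizer v h₁ h₂ (by decide) _)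
    apply Subtype.ext
    simp only [Matrix.SpecialLinearGroup.coe_mul, coe_reflT_one_two, coe_elemT]
    ext i j
    fin_cases i <;> fin_cases j <;>
      simp [mul_apply, Fin.sum_univ_three, single_apply, one_apply]
  have e20 : ∀ a : K, elem 2 0 (by decide) a ∈ rightStabilizer (cells 3 v h₁ h₂) := fun a => by
    refine c01 (x := elemT 2 1 (by decide) a) ?_ (e21 a)
    apply Subtype.ext
    simp only [Matrix.SpecialLinearGroup.coe_mul, coe_reflT_zero_one, coe_elemT]
    ext i j
    fin_cases i <;> fin_cases j <;>
      simp [mul_apply, Fin.sum_univ_three, single_apply, one_apply]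
  fin_cases i <;> fin_cases j <;> first | exact absurd hij (by decide) | skip
  exacts [e10 a, e20 a, e21 a]

/-- An element of the elementary subgroup of the extension that lies above the identity has
integral central coordinate. -/
theorem cent_le_one_of_mem_elementary (h₁ : ∀ a, v (D₁ a) ≤ v a) (h₂ : ∀ a, v (D₂ a) ≤ v a)
    {x : TraceExtension (Fin 3) D₁ D₂} (hx : x ∈ elementary D₁ D₂ 3) (hmat : x.mat = 1) :
    v x.cent ≤ 1 := by
  suffices x ∈ rightStabilizer (cells 3 v h₁ h₂) by
    have h := this 1 ⟨1, (integral v h₁ h₂).one_mem, 1, (borel v h₁ h₂).one_mem, mul_one _⟩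
    rw [one_mul] at h
    exact cent_le_one_of_mem_cells v h₁ h₂ h hmat
  clear hmat
  rw [elementary] at hx
  induction hx using Subgroup.closure_induction'' with
  | mem x hx =>
    obtain ⟨i, j, h, a, rfl⟩ := hx
    exact elem_mem_rightStabilizer_three v h₁ h₂ h a
  | inv_mem x hx =>
    obtain ⟨i, j, h, a, rfl⟩ := hx
    rw [elem_inv]
    exact elem_mem_rightStabilizer_three v h₁ h₂ h _
  | one => exact one_mem _
  | mul x y _ _ hx hy => exact mul_mem hx hy

end Rank

end TraceExtension

section Words

open scoped commutatorElement

/-- A word in elementary generators which for `a = x`, `b = -x⁻¹`, `s = 1` is the diagonal matrix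
with entries `x` and `x⁻¹` at `i` and `j`, and which is trivial for `a = b = s = 0`. -/
def torusWord {G R : Type*} [Group G] [CommRing R] {n : ℕ} (e : ∀ i j : Fin n, i ≠ j → R → G)
    {i j : Fin n} (h : i ≠ j) (a b s : R) : G :=
  e i j h a * e j i h.symm b * e i j h a * (e i j h (-s) * e j i h.symm s * e i j h (-s))

/-- A product of commutators of `torusWord`s. -/
def commutatorWord {G R : Type*} [Group G] [CommRing R] (e : ∀ i j : Fin 3, i ≠ j → R → G) {m : ℕ}
    (a b c d : Fin m → R) (s : R) : G :=
  (List.ofFn fun k => ⁅torusWord e (by decide : (0 : Fin 3) ≠ 1) (a k) (b k) s,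
    torusWord e (by decide : (0 : Fin 3) ≠ 2) (c k) (d k) s⁆).prod

theorem map_torusWord {G H R : Type*} [Group G] [Group H] [CommRing R] {n : ℕ} (f : G →* H)
    (e : ∀ i j : Fin n, i ≠ j → R → G) {i j : Fin n} (h : i ≠ j) (a b s : R) :
    f (torusWord e h a b s) = torusWord (fun i j h r => f (e i j h r)) h a b s := by
  simp only [torusWord, map_mul]

theorem map_commutatorWord {G H R : Type*} [Group G] [Group H] [CommRing R] (f : G →* H)
    (e : ∀ i j : Fin 3, i ≠ j → R → G) {m : ℕ} (a b c d : Fin m → R) (s : R) :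
    f (commutatorWord e a b c d s) =
      commutatorWord (fun i j h r => f (e i j h r)) a b c d s := by
  simp only [commutatorWord, map_list_prod, List.map_ofFn, Function.comp_def,
    map_commutatorElement, map_torusWord]

theorem comp_torusWord {G R S : Type*} [Group G] [CommRing R] [CommRing S] {n : ℕ} (f : R →+* S)
    (e : ∀ i j : Fin n, i ≠ j → S → G) {i j : Fin n} (h : i ≠ j) (a b s : R) :
    torusWord (fun i j h r => e i j h (f r)) h a b s = torusWord e h (f a) (f b) (f s) := by
  simp only [torusWord, map_neg]

theorem comp_commutatorWord {G R S : Type*} [Group G] [CommRing R] [CommRing S] (f : R →+* S)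
    (e : ∀ i j : Fin 3, i ≠ j → S → G) {m : ℕ} (a b c d : Fin m → R) (s : R) :
    commutatorWord (fun i j h r => e i j h (f r)) a b c d s =
      commutatorWord e (f ∘ a) (f ∘ b) (f ∘ c) (f ∘ d) (f s) := by
  simp only [commutatorWord, comp_torusWord, Function.comp_def]

theorem torusWord_mem {G R : Type*} [Group G] [CommRing R] {n : ℕ} {H : Subgroup G}
    {e : ∀ i j : Fin n, i ≠ j → R → G} (he : ∀ i j h r, e i j h r ∈ H) {i j : Fin n} (h : i ≠ j)
    (a b s : R) : torusWord e h a b s ∈ H :=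
  mul_mem (mul_mem (mul_mem (he ..) (he ..)) (he ..)) (mul_mem (mul_mem (he ..) (he ..)) (he ..))

theorem commutatorWord_mem {G R : Type*} [Group G] [CommRing R] {H : Subgroup G}
    {e : ∀ i j : Fin 3, i ≠ j → R → G} (he : ∀ i j h r, e i j h r ∈ H) {m : ℕ}
    (a b c d : Fin m → R) (s : R) : commutatorWord e a b c d s ∈ H := by
  refine list_prod_mem fun x hx => ?_
  obtain ⟨k, rfl⟩ := List.mem_ofFn.mp hx
  have h₁ := torusWord_mem he (by decide : (0 : Fin 3) ≠ 1) (a k) (b k) s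
  have h₂ := torusWord_mem he (by decide : (0 : Fin 3) ≠ 2) (c k) (d k) s
  exact mul_mem (mul_mem (mul_mem h₁ h₂) (inv_mem h₁)) (inv_mem h₂)

theorem commutatorWord_zero {G R : Type*} [Group G] [CommRing R]
    {e : ∀ i j : Fin 3, i ≠ j → R → G} (he : ∀ i j h, e i j h 0 = 1) {m : ℕ} :
    commutatorWord e (m := m) 0 0 0 0 0 = 1 := by
  simp only [commutatorWord, torusWord, Pi.zero_apply, neg_zero, he, mul_one,
    commutatorElement_self]
  simp

theorem coe_torusWord_zero_one {K : Type*} [Field K] {x : K} (hx : x ≠ 0) :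
    (torusWord (elemT (R := K)) (by decide : (0 : Fin 3) ≠ 1) x (-x⁻¹) 1).1 =
      diagonal ![x, x⁻¹, 1] := by
  simp only [torusWord, Matrix.SpecialLinearGroup.coe_mul, coe_elemT]
  ext i j
  fin_cases i <;> fin_cases j <;>
    simp [mul_apply, Fin.sum_univ_three, single_apply, one_apply, hx]

theorem coe_torusWord_zero_two {K : Type*} [Field K] {x : K} (hx : x ≠ 0) :
    (torusWord (elemT (R := K)) (by decide : (0 : Fin 3) ≠ 2) x (-x⁻¹) 1).1 =
      diagonal ![x, 1, x⁻¹] := by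
  simp only [torusWord, Matrix.SpecialLinearGroup.coe_mul, coe_elemT]
  ext i j
  fin_cases i <;> fin_cases j <;>
    simp [mul_apply, Fin.sum_univ_three, single_apply, one_apply, hx]

end Words

namespace TraceExtension

section Words

variable {n : ℕ} {R S : Type*} [CommRing R] [CommRing S] {D₁ D₂ : Derivation ℤ R R}

theorem elem_mem_elementary {i j : Fin n} (h : i ≠ j) (a : R) :
    elem i j h a ∈ elementary D₁ D₂ n :=
  Subgroup.subset_closure ⟨i, j, h, a, rfl⟩

theorem elem_zero {i j : Fin n} (h : i ≠ j) :
    (elem i j h 0 : TraceExtension (Fin n) D₁ D₂) = 1 :=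
  TraceExtension.ext (elemT_zero h) rfl

theorem map_elem (f : R →+* S) {D₁' D₂' : Derivation ℤ S S} (h₁ : ∀ a, f (D₁ a) = D₁' (f a))
    (h₂ : ∀ a, f (D₂ a) = D₂' (f a)) {i j : Fin n} (h : i ≠ j) (a : R) :
    map f h₁ h₂ (elem i j h a) = elem i j h (f a) :=
  TraceExtension.ext (map_elemT f h a) (map_zero f)

theorem map_mem_elementary (f : R →+* S) {D₁' D₂' : Derivation ℤ S S}
    (h₁ : ∀ a, f (D₁ a) = D₁' (f a)) (h₂ : ∀ a, f (D₂ a) = D₂' (f a))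
    {x : TraceExtension (Fin n) D₁ D₂} (hx : x ∈ elementary D₁ D₂ n) :
    map f h₁ h₂ x ∈ elementary D₁' D₂' n := by
  suffices elementary D₁ D₂ n ≤ (elementary D₁' D₂' n).comap (map f h₁ h₂) from this hx
  refine (Subgroup.closure_le _).mpr ?_
  rintro _ ⟨i, j, h, a, rfl⟩
  change map f h₁ h₂ (elem i j h a) ∈ elementary D₁' D₂' n
  rw [map_elem]
  exact elem_mem_elementary h _

theorem exists_lift_list_prod (L : List (Matrix.SpecialLinearGroup (Fin n) R))
    (hL : ∀ g ∈ L, g ∈ elemSet n R) :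
    ∃ (p : Fin L.length → R) (q : Fin L.length → Derivation ℤ R R → R),
      ∀ D₁ D₂ : Derivation ℤ R R, ∃ x ∈ elementary D₁ D₂ n,
        x.mat = L.prod ∧ x.cent = ∑ k, D₁ (p k) * q k D₂ := by
  induction L with
  | nil => exact ⟨Fin.elim0, Fin.elim0, fun D₁ D₂ => ⟨1, one_mem _, rfl, by simp⟩⟩
  | cons g L ih =>
    obtain ⟨p, q, h⟩ := ih fun g hg => hL g (List.mem_cons_of_mem _ hg)
    obtain ⟨i, j, hij, a, rfl⟩ := hL g List.mem_cons_self
    refine ⟨Fin.cons a p, Fin.cons (fun D => rightLogDeriv D L.prod j i) q, fun D₁ D₂ => ?_⟩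
    obtain ⟨x, hx, hmat, hcent⟩ := h D₁ D₂
    refine ⟨elem i j hij a * x, mul_mem (elem_mem_elementary hij a) hx, ?_, ?_⟩
    · rw [mat_mul, hmat, List.prod_cons]
      rfl
    · rw [cent_mul, hmat, hcent]
      refine Eq.trans ?_ (Fin.sum_univ_succ _).symm
      simp only [elem, traceCocycle_elemT, Fin.cons_zero, Fin.cons_succ]
      ring

theorem traceCocycle_of_diagonal {ι : Type*} [Fintype ι] [DecidableEq ι]
    {g h : Matrix.SpecialLinearGroup ι R} {a a' b b' : ι → R} (hg : g.1 = diagonal a)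
    (hg' : g⁻¹.1 = diagonal a') (hh : h.1 = diagonal b) (hh' : h⁻¹.1 = diagonal b') :
    traceCocycle D₁ D₂ g h = ∑ i, a' i * D₁ (a i) * (D₂ (b i) * b' i) := by
  rw [traceCocycle, leftLogDeriv, rightLogDeriv, hg, hg', hh, hh', diagonal_map (map_zero D₁),
    diagonal_map (map_zero D₂), diagonal_mul_diagonal, diagonal_mul_diagonal,
    diagonal_mul_diagonal, trace_diagonal]

end Words

section Field

open scoped commutatorElement

variable {K : Type*} [Field K] (D₁ D₂ : Derivation ℤ K K)

theorem coe_inv_eq_diagonal {ι : Type*} [Fintype ι] [DecidableEq ι]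
    {g : Matrix.SpecialLinearGroup ι K} {a b : ι → K} (hg : g.1 = diagonal a)
    (hab : ∀ i, a i * b i = 1) : g⁻¹.1 = diagonal b := by
  have h : g.1 * diagonal b = 1 := by
    rw [hg, diagonal_mul_diagonal, ← diagonal_one]
    exact congrArg diagonal (funext hab)
  calc g⁻¹.1 = g⁻¹.1 * (g.1 * diagonal b) := by rw [h, Matrix.mul_one]
    _ = diagonal b := by rw [← Matrix.mul_assoc, coe_inv_mul_coe, Matrix.one_mul]

theorem commutator_torusWord {x y : K} (hx : x ≠ 0) (hy : y ≠ 0) :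
    ⁅(torusWord (elem (D₁ := D₁) (D₂ := D₂)) (by decide : (0 : Fin 3) ≠ 1) x (-x⁻¹) 1),
      torusWord (elem (D₁ := D₁) (D₂ := D₂)) (by decide : (0 : Fin 3) ≠ 2) y (-y⁻¹) 1⁆ =
      ⟨1, D₁ x / x * (D₂ y / y) - D₁ y / y * (D₂ x / x)⟩ := by
  have ha : (torusWord (elem (D₁ := D₁) (D₂ := D₂)) (by decide : (0 : Fin 3) ≠ 1) x
      (-x⁻¹) 1).mat.1 = diagonal ![x, x⁻¹, 1] := by
    rw [← coe_torusWord_zero_one hx]; rfl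
  have hb : (torusWord (elem (D₁ := D₁) (D₂ := D₂)) (by decide : (0 : Fin 3) ≠ 2) y
      (-y⁻¹) 1).mat.1 = diagonal ![y, 1, y⁻¹] := by
    rw [← coe_torusWord_zero_two hy]; rfl
  have ha' := coe_inv_eq_diagonal (b := ![x⁻¹, x, 1]) ha (by simp [Fin.forall_fin_succ, hx])
  have hb' := coe_inv_eq_diagonal (b := ![y⁻¹, 1, y]) hb (by simp [Fin.forall_fin_succ, hy])
  rw [commutatorElement_eq, traceCocycle_of_diagonal ha ha' hb hb',
    traceCocycle_of_diagonal hb hb' ha ha']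
  · simp [Fin.sum_univ_three]
    ring
  · apply Subtype.ext
    rw [Matrix.SpecialLinearGroup.coe_mul, Matrix.SpecialLinearGroup.coe_mul, ha, hb,
      diagonal_mul_diagonal, diagonal_mul_diagonal]
    simp only [mul_comm]

theorem cent_commutatorWord {m : ℕ} {x y : Fin m → K} (hx : ∀ k, x k ≠ 0) (hy : ∀ k, y k ≠ 0) :
    (commutatorWord (elem (D₁ := D₁) (D₂ := D₂)) x (fun k => -(x k)⁻¹) y (fun k => -(y k)⁻¹)
      1).cent = ∑ k, (D₁ (x k) / x k * (D₂ (y k) / y k) - D₁ (y k) / y k * (D₂ (x k) / x k)) := by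
  simp only [commutatorWord, commutator_torusWord D₁ D₂ (hx _) (hy _)]
  rw [prod_of_mat_eq_one, List.map_ofFn, List.sum_ofFn]
  · rfl
  · intro z hz
    obtain ⟨k, rfl⟩ := List.mem_ofFn.mp hz
    rfl

end Field

section Polynomial

open Polynomial

variable {F : Type*} [Field F] {D₁ D₂ : Derivation ℤ F F}

theorem algebraMap_cent_le_one {K Γ : Type*} [Field K] [Algebra F[X] K]
    [IsFractionRing F[X] K] [LinearOrderedCommGroupWithZero Γ] (v : Valuation K Γ)
    (hv : ∀ p q : F[X], q ≠ 0 → p.natDegree ≤ q.natDegree →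
      v (algebraMap F[X] K p) ≤ v (algebraMap F[X] K q))
    {x : TraceExtension (Fin 3) (coeffDerivation D₁) (coeffDerivation D₂)}
    (hx : x ∈ elementary _ _ 3) (hmat : x.mat = 1) : v (algebraMap F[X] K x.cent) ≤ 1 := by
  obtain ⟨D₁', h₁, hv₁⟩ := exists_derivation_fractionField v hv D₁
  obtain ⟨D₂', h₂, hv₂⟩ := exists_derivation_fractionField v hv D₂
  refine cent_le_one_of_mem_elementary v hv₁ hv₂ (map_mem_elementary (algebraMap F[X] K)
    (fun a => (h₁ a).symm) (fun a => (h₂ a).symm) hx) ?_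
  change Matrix.SpecialLinearGroup.map _ x.mat = 1
  rw [hmat, map_one]

open scoped Classical in
theorem natDegree_cent_eq_zero
    {x : TraceExtension (Fin 3) (coeffDerivation D₁) (coeffDerivation D₂)}
    (hx : x ∈ elementary _ _ 3) (hmat : x.mat = 1) : x.cent.natDegree = 0 :=
  natDegree_eq_zero_of_inftyValuation_le_one
    (algebraMap_cent_le_one _ inftyValuation_algebraMap_le hx hmat)

theorem eval_cent_sub_eval_cent
    {x y : TraceExtension (Fin 3) (coeffDerivation D₁) (coeffDerivation D₂)}
    (hx : x ∈ elementary _ _ 3) (hy : y ∈ elementary _ _ 3) (h : x.mat = y.mat) (r s : F) :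
    x.cent.eval r - x.cent.eval s = y.cent.eval r - y.cent.eval s := by
  have hz : (x * y⁻¹).mat = 1 := by simp [h]
  obtain ⟨c, hc⟩ := natDegree_eq_zero.mp (natDegree_cent_eq_zero (mul_mem hx (inv_mem hy)) hz)
  have hxy : x.cent = C c + y.cent := by
    rw [hc, ← cent_mul_of_mat_eq_one hz, inv_mul_cancel_right]
  simp [hxy]

/-- The polynomial `commutatorWord` that is trivial at `0` and diagonal at `1`. -/
noncomputable def polynomialWord {G : Type*} [Group G] (e : ∀ i j : Fin 3, i ≠ j → F[X] → G)
    {m : ℕ} (x y : Fin m → F) : G :=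
  commutatorWord e (fun k => C (x k) * X) (fun k => C (-(x k)⁻¹) * X) (fun k => C (y k) * X)
    (fun k => C (-(y k)⁻¹) * X) X

theorem map_polynomialWord (r : F) (h₁ : D₁ r = 0) (h₂ : D₂ r = 0) {m : ℕ} (x y : Fin m → F) :
    map (evalRingHom r) (evalRingHom_coeffDerivation D₁ h₁)
      (evalRingHom_coeffDerivation D₂ h₂)
      (polynomialWord elem x y) = commutatorWord (G := TraceExtension (Fin 3) D₁ D₂) elem
        (fun k => x k * r) (fun k => -(x k)⁻¹ * r) (fun k => y k * r) (fun k => -(y k)⁻¹ * r)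
        r := by
  rw [polynomialWord, map_commutatorWord]
  simp only [map_elem]
  rw [comp_commutatorWord (evalRingHom r) elem]
  simp [Function.comp_def]

theorem eval_cent_polynomialWord {m : ℕ} {x y : Fin m → F} (hx : ∀ k, x k ≠ 0)
    (hy : ∀ k, y k ≠ 0) :
    letI c := (polynomialWord (elem (D₁ := coeffDerivation D₁) (D₂ := coeffDerivation D₂)) x y).cent
    c.eval 1 - c.eval 0 =
      ∑ k, (D₁ (x k) / x k * (D₂ (y k) / y k) - D₁ (y k) / y k * (D₂ (x k) / x k)) := by
  have h0 := congrArg cent (map_polynomialWord (0 : F) (map_zero D₁) (map_zero D₂) x y)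
  have h1 := congrArg cent (map_polynomialWord (1 : F) D₁.map_one_eq_zero D₂.map_one_eq_zero x y)
  simp only [mul_one, cent_commutatorWord D₁ D₂ hx hy] at h1
  simp only [mul_zero] at h0
  rw [show commutatorWord elem (fun _ => (0 : F)) (fun _ => 0) (fun _ => 0) (fun _ => 0) 0 =
    (1 : TraceExtension (Fin 3) D₁ D₂) from commutatorWord_zero fun _ _ h => elem_zero h] at h0
  exact (congrArg₂ (· - ·) h1 h0).trans (sub_zero _)

theorem mat_polynomialWord {m : ℕ} (x y : Fin m → F) :
    (polynomialWord (elem (D₁ := coeffDerivation D₁) (D₂ := coeffDerivation D₂)) x y).mat =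
      polynomialWord elemT x y :=
  map_commutatorWord (matHom (coeffDerivation D₁) (coeffDerivation D₂)) elem _ _ _ _ _

theorem polynomialWord_mem_elementary {m : ℕ} (x y : Fin m → F) :
    polynomialWord elem x y ∈ elementary (coeffDerivation D₁) (coeffDerivation D₂) 3 :=
  commutatorWord_mem (fun _ _ h r => elem_mem_elementary h r) _ _ _ _ _

/-- If derivations can take arbitrary values at the `2 * m` parameters, then `polynomialWord` is not
a product of fewer than `m / 2` elementary transvections. -/
theorem not_isElemProd_polynomialWord {N m : ℕ} (hm : 2 * N < m) {x y : Fin m → F}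
    (hx : ∀ k, x k ≠ 0) (hy : ∀ k, y k ≠ 0)
    (hder : ∀ a b : Fin m → F, ∃ D : Derivation ℤ F F, (∀ k, D (x k) = a k) ∧ ∀ k, D (y k) = b k) :
    ¬ IsElemProd 3 F[X] N (polynomialWord elemT x y) := by
  choose d hdx hdy using hder
  rintro ⟨L, hlen, hL, hprod⟩
  obtain ⟨p, q, h⟩ := exists_lift_list_prod L hL
  let D₁ (i : Fin m) := d (Pi.single i (x i)) 0
  let D₂ (j : Fin m) := d 0 (Pi.single j (y j))
  let A : Matrix (Fin m) (Fin L.length ⊕ Fin L.length) F := fun i =>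
    Sum.elim (fun k => (coeffDerivation (D₁ i) (p k)).eval 1)
      (fun k => (coeffDerivation (D₁ i) (p k)).eval 0)
  let B : Matrix (Fin L.length ⊕ Fin L.length) (Fin m) F := fun k j =>
    Sum.elim (fun k => (q k (coeffDerivation (D₂ j))).eval 1)
      (fun k => -(q k (coeffDerivation (D₂ j))).eval 0) k
  have hAB : A * B = 1 := by
    ext i j
    obtain ⟨z, hz, hmat, hcent⟩ := h (coeffDerivation (D₁ i)) (coeffDerivation (D₂ j))
    have hw := eval_cent_sub_eval_cent hz (polynomialWord_mem_elementary x y)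
      (by rw [hmat, ← hprod, mat_polynomialWord]) 1 0
    rw [eval_cent_polynomialWord hx hy, hcent] at hw
    calc (A * B) i j = _ := by
          rw [mul_apply, Fintype.sum_sum_type]
          simp only [A, B, Sum.elim_inl, Sum.elim_inr, mul_neg, Finset.sum_neg_distrib,
            ← sub_eq_add_neg, ← eval_mul, ← eval_finsetSum]
      _ = _ := hw
      _ = ∑ k, (1 : Matrix (Fin m) (Fin m) F) i k * (1 : Matrix (Fin m) (Fin m) F) j k := by
          refine Finset.sum_congr rfl fun k _ => ?_
          have hsingle : ∀ (u : Fin m → F) (_ : ∀ k, u k ≠ 0) (i : Fin m),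
              Pi.single (M := fun _ => F) i (u i) k / u k = (1 : Matrix (Fin m) (Fin m) F) i k :=
            fun u hu i => by
              rw [Pi.single_apply, one_apply]
              by_cases hk : k = i
              · subst hk; simp [hu]
              · simp [hk, Ne.symm hk]
          simp only [D₁, D₂, hdx, hdy, hsingle x hx, hsingle y hy, Pi.zero_apply, zero_div,
            zero_mul, sub_zero]
      _ = (1 : Matrix (Fin m) (Fin m) F) i j := by
          simp [one_apply]
  have hrank := (rank_mul_le_left A B).trans (rank_le_card_width A)
  rw [hAB, rank_one] at hrank
  simp only [Fintype.card_sum, Fintype.card_fin] at hrank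
  omega

end Polynomial

end TraceExtension

/-- van der Kallen: SL(3, ℂ[t]) does not have bounded word length with respect to
the elementary generators. -/
theorem sl3_polynomial_complex_not_boundedly_elementary :
    ∀ N : ℕ, ∃ g : Matrix.SpecialLinearGroup (Fin 3) (Polynomial ℂ),
      ¬ IsElemProd 3 (Polynomial ℂ) N g := by
  intro N
  obtain ⟨z, hz, hder⟩ := Complex.exists_derivations (2 * N + 1)
  refine ⟨TraceExtension.polynomialWord elemT (z ∘ Sum.inl) (z ∘ Sum.inr),
    TraceExtension.not_isElemProd_polynomialWord (Nat.lt_succ_self _) (fun k => hz _)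
      (fun k => hz _) fun a b => ?_⟩
  obtain ⟨D, hD⟩ := hder (Sum.elim a b)
  exact ⟨D, fun k => hD (Sum.inl k), fun k => hD (Sum.inr k)⟩
end

section
/- Let R be a commutative ring and n ≥ 3. Then for every g ∈ GL(n,R), every pair of indices 1 ≤ i ≠ j ≤ n and every ξ ∈ R, the conjugate g·t_ij(ξ)·g⁻¹ is a product of at most 4n(n−1) elementary transvections. -/
open Matrix

/-- g ∈ GL(n,R) is a product of at most N elementary transvections. -/
def IsElemProdGL (n : ℕ) (R : Type*) [CommRing R] (N : ℕ) (g : GL (Fin n) R) : Prop :=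
  ∃ L : List (Matrix.SpecialLinearGroup (Fin n) R),
    L.length ≤ N ∧ (∀ x ∈ L, x ∈ elemSet n R) ∧
    g = Matrix.SpecialLinearGroup.toGL L.prod

/-- The matrix `M` is a product of at most `N` elementary transvections. -/
def IsElemProdMatrix {n : ℕ} {R : Type*} [CommRing R] (N : ℕ)
    (M : Matrix (Fin n) (Fin n) R) : Prop :=
  ∃ L : List (Matrix.SpecialLinearGroup (Fin n) R),
    L.length ≤ N ∧ (∀ x ∈ L, x ∈ elemSet n R) ∧ M = (L.prod : Matrix (Fin n) (Fin n) R)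

namespace IsElemProdMatrix

variable {n : ℕ} {R : Type*} [CommRing R]

theorem mono {N N' : ℕ} {M : Matrix (Fin n) (Fin n) R} (h : IsElemProdMatrix N M)
    (hN : N ≤ N') : IsElemProdMatrix N' M := by
  obtain ⟨L, hL, hmem, rfl⟩ := h
  exact ⟨L, hL.trans hN, hmem, rfl⟩

theorem one : IsElemProdMatrix 0 (1 : Matrix (Fin n) (Fin n) R) :=
  ⟨[], by simp, by simp, by simp⟩

theorem mul {N N' : ℕ} {M M' : Matrix (Fin n) (Fin n) R} (h : IsElemProdMatrix N M)
    (h' : IsElemProdMatrix N' M') : IsElemProdMatrix (N + N') (M * M') := by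
  obtain ⟨L, hL, hmem, rfl⟩ := h
  obtain ⟨L', hL', hmem', rfl⟩ := h'
  refine ⟨L ++ L', by simp only [List.length_append]; omega, ?_, by simp⟩
  intro x hx
  exact (List.mem_append.1 hx).elim (hmem x) (hmem' x)

theorem one_add_single {i j : Fin n} (hij : i ≠ j) (c : R) :
    IsElemProdMatrix 1 (1 + single i j c) :=
  ⟨[elemT i j hij c], by simp, by simpa using ⟨i, j, hij, c, rfl⟩, by
    rw [List.prod_singleton]; rfl⟩

theorem one_add_sum_single_col (m : Fin n) (c : Fin n → R) (S : Finset (Fin n)) (hm : m ∉ S) :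
    IsElemProdMatrix S.card (1 + ∑ k ∈ S, single k m (c k)) := by
  induction S using Finset.induction_on with
  | empty => simpa using one
  | insert a S ha ih =>
    rw [Finset.mem_insert, not_or] at hm
    rw [Finset.card_insert_of_notMem ha, Finset.sum_insert ha]
    convert (ih hm.2).mul (one_add_single (Ne.symm hm.1) (c a)) using 1
    have : (∑ k ∈ S, single k m (c k)) * single a m (c a) = 0 := by
      rw [Finset.sum_mul]
      exact Finset.sum_eq_zero fun k _ => single_mul_single_of_ne _ _ _ _ hm.1 _
    rw [add_mul, one_mul, mul_add, this]
    simp only [mul_one]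
    abel

theorem one_add_sum_single_row (m : Fin n) (c : Fin n → R) (S : Finset (Fin n)) (hm : m ∉ S) :
    IsElemProdMatrix S.card (1 + ∑ k ∈ S, single m k (c k)) := by
  induction S using Finset.induction_on with
  | empty => simpa using one
  | insert a S ha ih =>
    rw [Finset.mem_insert, not_or] at hm
    rw [Finset.card_insert_of_notMem ha, Finset.sum_insert ha]
    convert (ih hm.2).mul (one_add_single hm.1 (c a)) using 1
    have : (∑ k ∈ S, single m k (c k)) * single m a (c a) = 0 := by
      rw [Finset.sum_mul]
      refine Finset.sum_eq_zero fun k hk => single_mul_single_of_ne _ _ _ _ ?_ _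
      rintro rfl
      exact hm.2 hk
    rw [add_mul, one_mul, mul_add, this]
    simp only [mul_one]
    abel

theorem one_add_vecMulVec_col {m : Fin n} {c : Fin n → R} (hc : c m = 0) :
    IsElemProdMatrix (n - 1) (1 + vecMulVec c (Pi.single m 1)) := by
  convert one_add_sum_single_col m c (Finset.univ.erase m) (by simp) using 2
  · simp
  · rw [Finset.sum_erase _ (by simp [hc])]
    ext a b
    simp [vecMulVec_apply, Matrix.sum_apply, single_apply, Pi.single_apply, ite_and, eq_comm]

theorem one_add_vecMulVec_row {m : Fin n} {c : Fin n → R} (hc : c m = 0) :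
    IsElemProdMatrix (n - 1) (1 + vecMulVec (Pi.single m 1) c) := by
  convert one_add_sum_single_row m c (Finset.univ.erase m) (by simp) using 2
  · simp
  · rw [Finset.sum_erase _ (by simp [hc])]
    ext a b
    simp [vecMulVec_apply, Matrix.sum_apply, single_apply, Pi.single_apply, ite_and, eq_comm]

theorem one_add_vecMulVec_of_apply_eq_zero {m : Fin n} {u v : Fin n → R} (hv : v m = 0)
    (hvu : v ⬝ᵥ u = 0) : IsElemProdMatrix (4 * (n - 1)) (1 + vecMulVec u v) := by
  set e : Fin n → R := Pi.single m 1 with he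
  set u' : Fin n → R := u - u m • e with hu'
  have hu'm : u' m = 0 := by simp [hu', he]
  have hvu' : v ⬝ᵥ u' = 0 := by simp [hu', he, dotProduct_sub, hvu, hv]
  have h := (((one_add_vecMulVec_col hu'm).mul (one_add_vecMulVec_row hv)).mul
    (one_add_vecMulVec_col (c := -u') (m := m) (by simp [hu'm]))).mul
    (one_add_vecMulVec_row (c := (u m - 1) • v) (m := m) (by simp [hv]))
  convert h.mono (by omega : _ ≤ 4 * (n - 1)) using 1
  rw [← he]
  have hPP : vecMulVec u' e * vecMulVec u' e = 0 := by
    rw [vecMulVec_mul_vecMulVec]; simp [he, hu'm]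
  have hQQ : vecMulVec e v * vecMulVec e v = 0 := by
    rw [vecMulVec_mul_vecMulVec]; simp [he, hv]
  have hQP : vecMulVec e v * vecMulVec u' e = 0 := by
    rw [vecMulVec_mul_vecMulVec]; simp [hvu']
  have hPQ : vecMulVec u' e * vecMulVec e v = vecMulVec u' v := by
    rw [vecMulVec_mul_vecMulVec]; simp [he]
  have huv : vecMulVec u v = vecMulVec u' e * vecMulVec e v + u m • vecMulVec e v := by
    rw [hPQ, ← smul_vecMulVec, ← add_vecMulVec, hu', sub_add_cancel]
  rw [huv, neg_vecMulVec, vecMulVec_smul]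
  generalize vecMulVec u' e = P at *
  generalize vecMulVec e v = Q at *
  have hPQP : P * Q * P = 0 := by rw [mul_assoc, hQP, mul_zero]
  have hPQQ : P * Q * Q = 0 := by rw [mul_assoc, hQQ, mul_zero]
  simp only [add_mul, mul_add, one_mul, mul_one, mul_neg, neg_mul, Matrix.mul_smul, hPP, hQQ, hQP,
    hPQP, hPQQ, smul_zero, add_zero]
  module

theorem one_add_vecMulVec (hn : 3 ≤ n) {u v w : Fin n → R} (hvu : v ⬝ᵥ u = 0)
    (hwu : w ⬝ᵥ u = 1) : IsElemProdMatrix (12 * (n - 1)) (1 + vecMulVec u v) := by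
  obtain ⟨i, j, k, hij, hik, hjk⟩ : ∃ i j k : Fin n, i ≠ j ∧ i ≠ k ∧ j ≠ k :=
    ⟨⟨0, by omega⟩, ⟨1, by omega⟩, ⟨2, by omega⟩, by simp, by simp, by simp⟩
  set a : Fin n → R := v i • w - w i • v with ha
  set s : Fin n → R := v i • Pi.single i 1 - u i • a with hs
  set y : Fin n → R := a j • (u j • Pi.single i 1 - u i • Pi.single j 1) with hy
  have hau : a ⬝ᵥ u = v i := by simp [ha, sub_dotProduct, hvu, hwu]
  have hsu : s ⬝ᵥ u = 0 := by simp [hs, sub_dotProduct, hau, mul_comm]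
  have hyu : y ⬝ᵥ u = 0 := by simp [hy, sub_dotProduct, mul_comm]
  have h₁ : IsElemProdMatrix (4 * (n - 1)) (1 + vecMulVec u (v - s)) :=
    one_add_vecMulVec_of_apply_eq_zero (m := i) (by simp [hs, ha, mul_comm])
      (by rw [sub_dotProduct, hvu, hsu, sub_zero])
  have h₂ : IsElemProdMatrix (4 * (n - 1)) (1 + vecMulVec u (s - y)) :=
    one_add_vecMulVec_of_apply_eq_zero (m := j) (by simp [hs, hy, hij.symm, mul_comm])
      (by rw [sub_dotProduct, hyu, hsu, sub_zero])
  have h₃ : IsElemProdMatrix (4 * (n - 1)) (1 + vecMulVec u y) :=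
    one_add_vecMulVec_of_apply_eq_zero (m := k) (by simp [hy, hik.symm, hjk.symm]) hyu
  have hmul (p q : Fin n → R) (hp : p ⬝ᵥ u = 0) :
      (1 + vecMulVec u p) * (1 + vecMulVec u q) = 1 + vecMulVec u (p + q) := by
    rw [add_mul, mul_add, mul_add, vecMulVec_mul_vecMulVec, hp, vecMulVec_add]
    simp [add_assoc, add_comm]
  convert ((h₁.mul h₂).mul h₃).mono (by omega : _ ≤ 12 * (n - 1)) using 1
  rw [hmul _ _ (by rw [sub_dotProduct, hvu, hsu, sub_zero]), sub_add_sub_cancel,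
    hmul _ _ (by rw [sub_dotProduct, hvu, hyu, sub_zero]), sub_add_cancel]

end IsElemProdMatrix

theorem conj_transvection_eq {n : ℕ} {R : Type*} [CommRing R] (g : GL (Fin n) R)
    (i j : Fin n) (ξ : R) :
    (g : Matrix (Fin n) (Fin n) R) * transvection i j ξ * ((g⁻¹ : GL (Fin n) R) : Matrix _ _ R) =
      1 + vecMulVec ((g : Matrix (Fin n) (Fin n) R).col i)
        (ξ • ((g⁻¹ : GL (Fin n) R) : Matrix (Fin n) (Fin n) R).row j) := by
  have hs : single i j ξ = vecMulVec (Pi.single i 1) (ξ • Pi.single j 1 : Fin n → R) := by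
    rw [vecMulVec_smul, ← single_eq_single_vecMulVec_single]; simp
  rw [transvection, mul_add, add_mul, mul_one, ← Units.val_mul, mul_inv_cancel, Units.val_one, hs,
    mul_vecMulVec, vecMulVec_mul, smul_vecMul, mulVec_single_one, single_one_vecMul]

/-- Decomposition of unipotents: for n ≥ 3, any conjugate g·t_ij(ξ)·g⁻¹ with
g ∈ GL(n,R) is a product of at most 4n(n−1) elementary transvections. -/
theorem conjugate_transvection_is_elemProd (n : ℕ) (hn : 3 ≤ n)
    (R : Type*) [CommRing R] (g : GL (Fin n) R)
    (i j : Fin n) (hij : i ≠ j) (ξ : R) :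
    IsElemProdGL n R (4 * n * (n - 1))
      (g * Matrix.SpecialLinearGroup.toGL (elemT i j hij ξ) * g⁻¹) := by
  have hinv (k : Fin n) :
      ((g⁻¹ : GL (Fin n) R) : Matrix (Fin n) (Fin n) R).row k ⬝ᵥ
        (g : Matrix (Fin n) (Fin n) R).col i = (1 : Matrix (Fin n) (Fin n) R) k i := by
    rw [← Units.val_one, ← inv_mul_cancel g, Units.val_mul]
    rfl
  have h := IsElemProdMatrix.one_add_vecMulVec hn
    (v := ξ • ((g⁻¹ : GL (Fin n) R) : Matrix (Fin n) (Fin n) R).row j)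
    (by rw [smul_dotProduct, hinv, one_apply_ne hij.symm, smul_zero])
    ((hinv i).trans (one_apply_eq i))
  obtain ⟨L, hL, hmem, hprod⟩ := h.mono (Nat.mul_le_mul_right (n - 1) (by omega : 12 ≤ 4 * n))
  exact ⟨L, hL, hmem, Units.ext ((conj_transvection_eq g i j ξ).trans hprod)⟩
end
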